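/- arXiv:1311.2322 — 3 statements merged into one kernel-verified Lean document; each statement's English description precedes it below -/
import Mathlib

section
/- Let p_1, p_2 ∈ [1,∞) with 1/p_1 + 1/p_2 ≥ 1. Then the operator C_2^{(1,−1)} is not bounded from W_{p_1} × L^{p_2} into L^{1/(1/p_1+1/p_2)}: for every constant C > 0 there exist Schwartz functions f_1, f_2 with compactly supported Fourier transforms such that ‖C_2^{(1,−1)}(f_1,f_2)‖_{L^{1/(1/p_1+1/p_2)}(ℝ)} > C ‖f̂_1‖_{L^{p_1′}} ‖f_2‖_{L^{p_2}}. -/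
open MeasureTheory Complex
open scoped FourierTransform Real ENNReal

/-- The multilinear oscillatory integral operator `C_n^ε`. -/
noncomputable def Cop {n : ℕ} (ε : Fin n → ℝ) (f : Fin n → ℝ → ℂ) (x : ℝ) : ℂ :=
  ∫ t in {t : Fin n → ℝ | StrictMono t},
    (∏ i, 𝓕 (f i) (t i)) * Complex.exp (2 * π * Complex.I * x * ∑ i, ε i * t i)

/-- The conjugate exponent of `p ∈ [1,∞)` as an element of `ℝ≥0∞` (so `1′ = ∞`). -/
noncomputable def conjE (p : ℝ) : ℝ≥0∞ :=
  if p = 1 then ⊤ else ENNReal.ofReal (p / (p - 1))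

/-- In the difference variable, `C₂^{(1,-1)}(f, g)` is the projection onto negative frequencies of
the inverse Fourier transform of the cross-correlation of `𝓕 f` and `𝓕 g`. -/
lemma Cop_one_neg_one_eq {f g : ℝ → ℂ} (hf : Continuous (𝓕 f)) (hfc : HasCompactSupport (𝓕 f))
    (hg : Continuous (𝓕 g)) (hgc : HasCompactSupport (𝓕 g)) (x : ℝ) :
    Cop ![(1 : ℝ), -1] ![f, g] x =
      ∫ s in Set.Iic (0 : ℝ),
        (∫ t, 𝓕 f (s + t) * 𝓕 g t) * Complex.exp (2 * π * Complex.I * x * s) := by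
  set E : ℝ → ℂ := fun s => Complex.exp (2 * π * Complex.I * x * s) with hE
  set K : ℝ × ℝ → ℂ := fun z => (𝓕 f z.1 * 𝓕 g z.2) * E (z.1 - z.2)
  set A : Set (ℝ × ℝ) := {z | z.1 < z.2}
  have hKi : Integrable K (volume.prod volume) := by
    have hprod : Integrable (fun z : ℝ × ℝ => 𝓕 f z.1 * 𝓕 g z.2) (volume.prod volume) :=
      (hf.integrable_of_hasCompactSupport hfc).mul_prod (hg.integrable_of_hasCompactSupport hgc)
    refine hprod.mul_bdd (c := 1) (by fun_prop) (Filter.Eventually.of_forall fun z => ?_)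
    have : (2 * π * Complex.I * x * ((z.1 - z.2 : ℝ) : ℂ))
        = ((2 * π * x * (z.1 - z.2) : ℝ) : ℂ) * Complex.I := by push_cast; ring
    simp only [hE]
    rw [this, Complex.norm_exp_ofReal_mul_I]
  have h1 : Cop ![(1 : ℝ), -1] ![f, g] x = ∫ z in A, K z := by
    unfold Cop
    rw [← (volume_preserving_finTwoArrow ℝ).setIntegral_preimage_emb
      (MeasurableEquiv.measurableEmbedding _)]
    have hset : {t : Fin 2 → ℝ | StrictMono t} = MeasurableEquiv.finTwoArrow ⁻¹' A := by
      ext t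
      simp [A, Fin.strictMono_iff_lt_succ]
    rw [hset]
    refine integral_congr_ae (Filter.Eventually.of_forall fun t => ?_)
    simp [K, E, Fin.prod_univ_two, Fin.sum_univ_two, sub_eq_add_neg]
  have hshear := measurePreserving_add_prod (volume : Measure ℝ) (volume : Measure ℝ)
  have hemb : MeasurableEmbedding (fun z : ℝ × ℝ => (z.1 + z.2, z.2)) :=
    MeasurableEquiv.measurableEmbedding
      { toFun := fun z : ℝ × ℝ => (z.1 + z.2, z.2)
        invFun := fun z => (z.1 - z.2, z.2)
        left_inv := fun z => by simp
        right_inv := fun z => by simp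
        measurable_toFun := (measurable_fst.add measurable_snd).prodMk measurable_snd
        measurable_invFun := (measurable_fst.sub measurable_snd).prodMk measurable_snd }
  have hpre : (fun z : ℝ × ℝ => (z.1 + z.2, z.2)) ⁻¹' A = Set.Iio (0 : ℝ) ×ˢ Set.univ := by
    ext z
    simp [A]
  rw [h1, Measure.volume_eq_prod, ← hshear.setIntegral_preimage_emb hemb, hpre,
    setIntegral_prod (fun z : ℝ × ℝ => K (z.1 + z.2, z.2))
      (hshear.integrable_comp_of_integrable hKi).integrableOn,
    integral_Iic_eq_integral_Iio]
  refine integral_congr_ae (Filter.Eventually.of_forall fun s => ?_)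
  simp [K, E, integral_mul_const]

/-- The inverse Fourier integral over the negative half-line of a `C¹` function `H` is asymptotic
to `H 0 / (2πix)`. -/
lemma tendsto_mul_integral_Iic_mul_exp {H : ℝ → ℂ} (hH : ContDiff ℝ 1 H)
    (hHc : HasCompactSupport H) :
    Filter.Tendsto (fun x : ℝ => 2 * π * Complex.I * x *
      ∫ s in Set.Iic (0 : ℝ), H s * Complex.exp (2 * π * Complex.I * x * s))
      (Filter.cocompact ℝ) (nhds (H 0)) := by
  set G : ℝ → ℂ := (Set.Iic (0 : ℝ)).indicator (deriv H) with hG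
  have hRL : Filter.Tendsto (fun x : ℝ => 𝓕 G (-x)) (Filter.cocompact ℝ) (nhds 0) :=
    (Real.zero_at_infty_fourier G).comp (Homeomorph.neg ℝ).isClosedEmbedding.tendsto_cocompact
  have hGx (x : ℝ) : 𝓕 G (-x) =
      ∫ s in Set.Iic (0 : ℝ), deriv H s * Complex.exp (2 * π * Complex.I * x * s) := by
    rw [Real.fourier_real_eq_integral_exp_smul, ← integral_indicator measurableSet_Iic]
    refine integral_congr_ae (Filter.Eventually.of_forall fun s => ?_)
    by_cases hs : s ∈ Set.Iic (0 : ℝ)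
    · simp only [hG, Set.indicator_of_mem hs, smul_eq_mul]
      rw [mul_comm]
      congr 2
      push_cast
      ring
    · simp [hG, Set.indicator_of_notMem hs]
  have hparts (x : ℝ) : 2 * π * Complex.I * x *
      (∫ s in Set.Iic (0 : ℝ), H s * Complex.exp (2 * π * Complex.I * x * s)) =
      H 0 - 𝓕 G (-x) := by
    set E : ℝ → ℂ := fun s => Complex.exp (2 * π * Complex.I * x * s)
    have hEd : ContDiff ℝ 1 E := (contDiff_const.mul Complex.ofRealCLM.contDiff).cexp
    have hE' (s : ℝ) : HasDerivAt E (E s * (2 * π * Complex.I * x)) s := by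
      have h := ((hasDerivAt_id s).ofReal_comp.const_mul (2 * π * Complex.I * x)).cexp
      simpa using h
    have hd (s : ℝ) : deriv (fun s => H s * E s) s =
        deriv H s * E s + 2 * π * Complex.I * x * (H s * E s) := by
      have h := ((hH.differentiable one_ne_zero s).hasDerivAt.mul (hE' s)).deriv
      rw [show (fun s => H s * E s) = H * E from rfl, h]
      ring
    have hI := HasCompactSupport.integral_Iic_deriv_eq (hH.mul hEd) (hHc.mul_right (f' := E)) 0
    have hi1 : Integrable (fun s => deriv H s * E s) :=
      ((hH.continuous_deriv le_rfl).mul hEd.continuous).integrable_of_hasCompactSupport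
        hHc.deriv.mul_right
    have hi2 : Integrable (fun s => H s * E s) :=
      (hH.continuous.mul hEd.continuous).integrable_of_hasCompactSupport hHc.mul_right
    simp_rw [hd] at hI
    rw [integral_add hi1.integrableOn (hi2.const_mul _).integrableOn, integral_const_mul,
      ← hGx] at hI
    have hE0 : E 0 = 1 := by simp [E]
    rw [hE0, mul_one] at hI
    rw [← hI]
    ring
  simp_rw [hparts]
  simpa using hRL.const_sub (H 0)

/-- A function decaying exactly like `1 / x` at infinity is not in `L^r` for `r ≤ 1`. -/
lemma eLpNorm_eq_top_of_tendsto_mul {g : ℝ → ℂ} {L : ℂ} (hL : L ≠ 0)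
    (hg : Filter.Tendsto (fun x : ℝ => x * g x) Filter.atTop (nhds L)) {r : ℝ} (hr : 0 < r)
    (hr1 : r ≤ 1) : eLpNorm g (ENNReal.ofReal r) volume = ⊤ := by
  by_contra hfin
  set c : ℝ := ‖L‖ / 2 with hc
  have hcpos : 0 < c := by positivity
  have hev : ∀ᶠ x : ℝ in Filter.atTop, c < ‖(x : ℂ) * g x‖ :=
    hg.norm.eventually_const_lt (by rw [hc]; linarith [norm_pos_iff.mpr hL])
  obtain ⟨N₀, hN₀⟩ := Filter.eventually_atTop.mp hev
  set N := max N₀ 1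
  have hNpos : 0 < N := lt_of_lt_of_le one_pos (le_max_right _ _)
  set h : ℝ → ℝ := (Set.Ioi N).indicator fun x => c * x⁻¹ with hh
  have hmeas : AEStronglyMeasurable h volume :=
    ((measurable_const.mul measurable_inv).indicator measurableSet_Ioi).aestronglyMeasurable
  have hle (x : ℝ) : ‖h x‖ ≤ ‖g x‖ := by
    by_cases hx : x ∈ Set.Ioi N
    · have hxN : N < x := hx
      have hxpos : 0 < x := hNpos.trans hxN
      have := hN₀ x ((le_max_left _ _).trans hxN.le)
      rw [norm_mul, Complex.norm_real, Real.norm_of_nonneg hxpos.le] at this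
      rw [hh, Set.indicator_of_mem hx, Real.norm_of_nonneg (by positivity), ← div_eq_mul_inv,
        div_le_iff₀ hxpos, mul_comm]
      exact this.le
    · simp [hh, Set.indicator_of_notMem hx]
  have hmem : MemLp h (ENNReal.ofReal r) volume :=
    ⟨hmeas, (eLpNorm_mono hle).trans_lt (lt_top_iff_ne_top.mpr hfin)⟩
  have hint := hmem.integrable_norm_rpow (by simpa using hr) ENNReal.ofReal_ne_top
  rw [ENNReal.toReal_ofReal hr.le] at hint
  have hint' : IntegrableOn (fun x : ℝ => c ^ r * x ^ (-r)) (Set.Ioi N) := by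
    refine hint.integrableOn.congr_fun (fun x hx => ?_) measurableSet_Ioi
    have hxpos : 0 < x := hNpos.trans hx
    simp only [hh, Set.indicator_of_mem hx]
    rw [Real.norm_of_nonneg (by positivity), Real.mul_rpow hcpos.le (by positivity),
      Real.inv_rpow hxpos.le, Real.rpow_neg hxpos.le]
  have hint'' : IntegrableOn (fun x : ℝ => x ^ (-r)) (Set.Ioi N) := by
    have := hint'.const_mul (c ^ r)⁻¹
    refine IntegrableOn.congr_fun this (fun x _ => ?_) measurableSet_Ioi
    rw [inv_mul_cancel_left₀ (Real.rpow_pos_of_pos hcpos r).ne']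
  have := (integrableOn_Ioi_rpow_iff hNpos).mp hint''
  linarith

/-- If the Fourier transforms of `f` and `g` are smooth with compact support and
`∫ 𝓕 f * 𝓕 g ≠ 0`, then `C₂^{(1,-1)}(f, g)` has infinite `L^r` quasi-norm for `r ≤ 1`. -/
lemma eLpNorm_Cop_one_neg_one_eq_top {f g : ℝ → ℂ} (hf : ContDiff ℝ 1 (𝓕 f))
    (hfc : HasCompactSupport (𝓕 f)) (hg : ContDiff ℝ 1 (𝓕 g)) (hgc : HasCompactSupport (𝓕 g))
    (hfg : ∫ t, 𝓕 f t * 𝓕 g t ≠ 0) {r : ℝ} (hr : 0 < r) (hr1 : r ≤ 1) :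
    eLpNorm (Cop ![(1 : ℝ), -1] ![f, g]) (ENNReal.ofReal r) volume = ⊤ := by
  set H : ℝ → ℂ := fun s => ∫ t, 𝓕 f (s + t) * 𝓕 g t
  set ψ : ℝ → ℂ := fun t => 𝓕 g (-t)
  have hψc : HasCompactSupport ψ := hgc.comp_homeomorph (Homeomorph.neg ℝ)
  have hψd : ContDiff ℝ 1 ψ := hg.comp contDiff_neg
  have hconv : H = convolution (𝓕 f) ψ (ContinuousLinearMap.mul ℝ ℂ) volume := by
    ext s
    rw [convolution_def, ← integral_add_left_eq_self _ s]
    simp [H, ψ]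
  have hHd : ContDiff ℝ 1 H := by
    rw [hconv]
    exact HasCompactSupport.contDiff_convolution_right (n := 1) _ hψc
      hf.continuous.locallyIntegrable hψd
  have hHc : HasCompactSupport H := by
    rw [hconv]
    exact hfc.convolution _ hψc
  have hH0 : H 0 ≠ 0 := by simpa [H] using hfg
  have ht := (tendsto_mul_integral_Iic_mul_exp hHd hHc).mono_left _root_.atTop_le_cocompact
  have hk : (2 * π * Complex.I : ℂ) ≠ 0 := Complex.two_pi_I_ne_zero
  refine eLpNorm_eq_top_of_tendsto_mul (div_ne_zero hH0 hk) ?_ hr hr1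
  refine (ht.div_const (2 * π * Complex.I)).congr fun x => ?_
  rw [Cop_one_neg_one_eq hf.continuous hfc hg.continuous hgc, mul_assoc (2 * π * Complex.I : ℂ),
    mul_div_cancel_left₀ _ hk]

/-- for `1/p₁ + 1/p₂ ≥ 1` the operator `C₂^{(1,-1)}` is not bounded
from `W_{p₁} × L^{p₂}` into `L^{1/(1/p₁+1/p₂)}`. -/
theorem stmt12 (p₁ p₂ : ℝ) (hp₁ : 1 ≤ p₁) (hp₂ : 1 ≤ p₂)
    (hsum : 1 ≤ 1 / p₁ + 1 / p₂) (C : ℝ) (hC : 0 < C) :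
    ∃ f₁ f₂ : SchwartzMap ℝ ℂ,
      HasCompactSupport (𝓕 ⇑f₁) ∧ HasCompactSupport (𝓕 ⇑f₂) ∧
      ENNReal.ofReal C *
          eLpNorm (𝓕 ⇑f₁) (conjE p₁) volume *
          eLpNorm ⇑f₂ (ENNReal.ofReal p₂) volume <
        eLpNorm (Cop ![(1 : ℝ), -1] ![⇑f₁, ⇑f₂])
          (ENNReal.ofReal (1 / (1 / p₁ + 1 / p₂))) volume := by
  let b : ContDiffBump (0 : ℝ) := ⟨1, 2, one_pos, one_lt_two⟩
  have hbc : HasCompactSupport fun t : ℝ => (b t : ℂ) :=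
    b.hasCompactSupport.comp_left Complex.ofReal_zero
  let φ : SchwartzMap ℝ ℂ := hbc.toSchwartzMap (Complex.ofRealCLM.contDiff.comp b.contDiff)
  let f : SchwartzMap ℝ ℂ := 𝓕⁻ φ
  have hFf : 𝓕 ⇑f = fun t : ℝ => (b t : ℂ) := by
    rw [← SchwartzMap.fourier_coe, FourierTransform.fourier_fourierInv_eq]
    rfl
  have hφc : HasCompactSupport (𝓕 ⇑f) := hFf ▸ hbc
  have hφd : ContDiff ℝ 1 (𝓕 ⇑f) := by
    rw [hFf]
    exact Complex.ofRealCLM.contDiff.comp b.contDiff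
  have hne : ∫ t, 𝓕 ⇑f t * 𝓕 ⇑f t ≠ 0 := by
    have hpos : 0 < ∫ t, b t * b t := by
      refine (b.continuous.mul b.continuous).integral_pos_of_hasCompactSupport_nonneg_nonzero
        b.hasCompactSupport.mul_right (fun t => mul_self_nonneg (b t)) (x := 0) ?_
      simp [b.one_of_mem_closedBall (Metric.mem_closedBall_self b.rIn_pos.le)]
    simp only [hFf, ← Complex.ofReal_mul]
    rw [integral_complex_ofReal]
    exact_mod_cast hpos.ne'
  refine ⟨f, f, hφc, hφc, ?_⟩
  have hsum_pos : 0 < 1 / p₁ + 1 / p₂ := one_pos.trans_le hsum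
  rw [eLpNorm_Cop_one_neg_one_eq_top hφd hφc hφd hφc hne (one_div_pos.mpr hsum_pos)
    ((div_le_one hsum_pos).mpr hsum)]
  refine ENNReal.mul_lt_top (ENNReal.mul_lt_top ENNReal.ofReal_lt_top ?_) ?_
  · exact ((𝓕 f).memLp (conjE p₁) volume).eLpNorm_lt_top
  · exact (f.memLp (ENNReal.ofReal p₂) volume).eLpNorm_lt_top
end

section
/- Let n ≥ 2, ε ∈ {−1,1}ⁿ, p_1,…,p_n ∈ (1,∞), and for each j let X^j ∈ {L^{p_j}, W_{p_j}}. Suppose for some 1 ≤ i ≤ n−1 that 1/p_i + 1/p_{i+1} > 1, ε_i = −ε_{i+1}, X^i = W_{p_i}, and X^{i+1} = L^{p_{i+1}}. Then C_n^ε is not bounded from X^1 × ⋯ × X^n into L^{1/(Σ_{j=1}^n 1/p_j)}: for every constant C > 0 there exist Schwartz functions f_1,…,f_n with compactly supported Fourier transforms such that ‖C_n^ε(f_1,…,f_n)‖_{L^{1/(Σ 1/p_j)}(ℝ)} > C ∏_{j=1}^n ‖f_j‖_{X^j}. -/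
open MeasureTheory Complex
open scoped FourierTransform Real ENNReal

open Filter Set Topology

theorem norm_cexp_two_pi (y t : ℝ) : ‖cexp (2 * π * I * y * t)‖ = 1 := by
  rw [show (2 * π * I * y * t : ℂ) = (2 * π * y * t : ℝ) * I by push_cast; ring]
  exact norm_exp_ofReal_mul_I _

theorem continuous_cexp_two_pi (y : ℝ) : Continuous fun t : ℝ => cexp (2 * π * I * y * t) := by
  fun_prop

/-- The Riemann–Lebesgue lemma on a half-line. -/
theorem tendsto_setIntegral_Iic_mul_cexp (f : ℝ → ℂ) (s : ℝ) :
    Tendsto (fun y : ℝ => ∫ t in Iic s, f t * cexp (2 * π * I * y * t)) atTop (𝓝 0) := by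
  have h := (Real.tendsto_integral_exp_smul_cocompact ((Iic s).indicator f)).comp
    (tendsto_neg_atTop_atBot.mono_right atBot_le_cocompact)
  refine h.congr fun y => ?_
  rw [← integral_indicator measurableSet_Iic]
  refine integral_congr_ae (ae_of_all _ fun t => ?_)
  by_cases ht : t ∈ Iic s
  · simp only [indicator_of_mem ht, Circle.smul_def, Real.fourierChar_apply, smul_eq_mul]
    rw [mul_comm]
    congr 2
    push_cast
    ring
  · simp [indicator_of_notMem ht]

theorem continuous_setIntegral_Iic {f : ℝ → ℂ} (hf : Integrable f) :
    Continuous fun s => ∫ t in Iic s, f t := by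
  have h : (fun s => ∫ t in Iic s, f t) = fun s => (∫ t in Iic 0, f t) + ∫ t in (0 : ℝ)..s, f t := by
    ext s
    rw [← intervalIntegral.integral_Iic_sub_Iic hf.integrableOn hf.integrableOn]
    ring
  rw [h]
  exact continuous_const.add (intervalIntegral.continuous_primitive (fun _ _ => hf.intervalIntegrable) 0)

theorem two_pi_mul_setIntegral_Iic_mul_cexp {ψ : ℝ → ℂ} (hψ : ContDiff ℝ 1 ψ)
    (hc : HasCompactSupport ψ) (y s : ℝ) :
    2 * π * I * y * ∫ t in Iic s, ψ t * cexp (2 * π * I * y * t) =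
      ψ s * cexp (2 * π * I * y * s) - ∫ t in Iic s, deriv ψ t * cexp (2 * π * I * y * t) := by
  have hd : ∀ t, HasDerivAt (fun t : ℝ => ψ t * cexp (2 * π * I * y * t))
      (deriv ψ t * cexp (2 * π * I * y * t) +
        2 * π * I * y * (ψ t * cexp (2 * π * I * y * t))) t := fun t => by
    have h1 : HasDerivAt (fun t : ℝ => cexp (2 * π * I * y * t))
        (cexp (2 * π * I * y * t) * (2 * π * I * y * 1)) t :=
      (((hasDerivAt_id (t : ℂ)).const_mul (2 * π * I * y)).cexp).comp_ofReal
    refine ((hψ.differentiable one_ne_zero t).hasDerivAt.mul h1).congr_deriv ?_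
    ring
  have hcd : ContDiff ℝ 1 (fun t : ℝ => ψ t * cexp (2 * π * I * y * t)) := by
    refine hψ.mul (ContDiff.cexp (contDiff_const.mul ?_))
    exact ofRealCLM.contDiff
  have h := hc.mul_right (f' := fun t : ℝ => cexp (2 * π * I * y * t)) |>.integral_Iic_deriv_eq hcd s
  have hcont := continuous_cexp_two_pi y
  rw [integral_congr_ae (ae_of_all _ fun t => (hd t).deriv), integral_add, integral_const_mul] at h
  · rw [← h]; simp
  · exact (((hψ.continuous_deriv le_rfl).mul hcont).integrable_of_hasCompactSupport
      hc.deriv.mul_right).integrableOn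
  · exact (((hψ.continuous.mul hcont).integrable_of_hasCompactSupport
      hc.mul_right).const_mul _).integrableOn

/-- The ordered pairing `∫_{t < s} ψ(t) ψ(s) e^{2πiy(t - s)}` decays exactly like `1 / y`. -/
theorem tendsto_two_pi_mul_ordered_pairing {ψ : ℝ → ℂ} (hψ : ContDiff ℝ 1 ψ)
    (hc : HasCompactSupport ψ) :
    Tendsto (fun y : ℝ => 2 * π * I * y * ∫ s, ψ s * cexp (2 * π * I * (-y : ℝ) * s) *
        ∫ t in Iic s, ψ t * cexp (2 * π * I * y * t)) atTop (𝓝 (∫ s, ψ s * ψ s)) := by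
  have hd : Integrable (deriv ψ) :=
    (hψ.continuous_deriv le_rfl).integrable_of_hasCompactSupport hc.deriv
  have hde : ∀ y : ℝ, Integrable fun t : ℝ => deriv ψ t * cexp (2 * π * I * y * t) := fun y =>
    ((hψ.continuous_deriv le_rfl).mul (continuous_cexp_two_pi y)).integrable_of_hasCompactSupport
      hc.deriv.mul_right
  have hDcont : ∀ y : ℝ, Continuous fun s : ℝ => ψ s * cexp (2 * π * I * (-y : ℝ) * s) *
      ∫ t in Iic s, deriv ψ t * cexp (2 * π * I * y * t) := fun y =>
    (hψ.continuous.mul (continuous_cexp_two_pi (-y))).mul (continuous_setIntegral_Iic (hde y))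
  have key : ∀ y : ℝ, 2 * π * I * y * ∫ s, ψ s * cexp (2 * π * I * (-y : ℝ) * s) *
        ∫ t in Iic s, ψ t * cexp (2 * π * I * y * t) =
      (∫ s, ψ s * ψ s) - ∫ s, ψ s * cexp (2 * π * I * (-y : ℝ) * s) *
        ∫ t in Iic s, deriv ψ t * cexp (2 * π * I * y * t) := fun y => by
    rw [← integral_const_mul, ← integral_sub]
    · refine integral_congr_ae (ae_of_all _ fun s => ?_)
      have he : cexp (2 * π * I * (-y : ℝ) * s) * cexp (2 * π * I * y * s) = 1 := by
        rw [← Complex.exp_add]; push_cast; ring_nf; simp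
      have := two_pi_mul_setIntegral_Iic_mul_cexp hψ hc y s
      linear_combination ψ s * cexp (2 * π * I * (-y : ℝ) * s) * this + ψ s * ψ s * he
    · exact (hψ.continuous.mul hψ.continuous).integrable_of_hasCompactSupport hc.mul_right
    · exact (hDcont y).integrable_of_hasCompactSupport hc.mul_right.mul_right
  simp_rw [key]
  suffices h : Tendsto (fun y : ℝ => ∫ s, ψ s * cexp (2 * π * I * (-y : ℝ) * s) *
      ∫ t in Iic s, deriv ψ t * cexp (2 * π * I * y * t)) atTop (𝓝 0) by
    simpa only [sub_zero] using h.const_sub (∫ s, ψ s * ψ s)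
  have hlim := tendsto_integral_filter_of_dominated_convergence (l := atTop) (μ := volume)
    (F := fun (y s : ℝ) => ψ s * cexp (2 * π * I * (-y : ℝ) * s) *
      ∫ t in Iic s, deriv ψ t * cexp (2 * π * I * y * t)) (f := fun _ => (0 : ℂ))
    (fun s => ‖ψ s‖ * ∫ t, ‖deriv ψ t‖)
    (Eventually.of_forall fun y => (hDcont y).aestronglyMeasurable)
    (Eventually.of_forall fun y => ae_of_all _ fun s => ?_)
    (((hψ.continuous.integrable_of_hasCompactSupport hc).norm).mul_const _)
    (ae_of_all _ fun s => ?_)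
  · simpa using hlim
  · rw [norm_mul, norm_mul, norm_cexp_two_pi, mul_one]
    gcongr
    refine (norm_integral_le_integral_norm _).trans ?_
    simp_rw [norm_mul, norm_cexp_two_pi, mul_one]
    exact setIntegral_le_integral hd.norm (ae_of_all _ fun t => norm_nonneg (deriv ψ t))
  · refine squeeze_zero_norm (a := fun y : ℝ => ‖ψ s‖ * ‖∫ t in Iic s, deriv ψ t * cexp (2 * π * I * y * t)‖)
      (fun y => ?_) ?_
    · rw [norm_mul, norm_mul, norm_cexp_two_pi, mul_one]
    · simpa using ((tendsto_setIntegral_Iic_mul_cexp (deriv ψ) s).norm).const_mul ‖ψ s‖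

theorem setIntegral_lt_prod {m : ℕ} {h : Fin (m + 1) → ℝ → ℂ} (hI : ∀ j, Integrable (h j))
    (i : Fin (m + 1)) (k : Fin m) :
    ∫ t in {t : Fin (m + 1) → ℝ | t i < t (i.succAbove k)}, ∏ j, h j (t j) =
      (∏ j ∈ Finset.univ.erase k, ∫ x, h (i.succAbove j) x) *
        ∫ s, h (i.succAbove k) s * ∫ t in Iic s, h i t := by
  have hS : MeasurableSet {t : Fin (m + 1) → ℝ | t i < t (i.succAbove k)} :=
    measurableSet_lt (measurable_pi_apply _) (measurable_pi_apply _)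
  have hF := (Integrable.fintype_prod hI).indicator hS
  have hmp := (volume_preserving_piFinSuccAbove (fun _ : Fin (m + 1) => ℝ) i).symm
  rw [← integral_indicator hS, ← hmp.integral_comp', Measure.volume_eq_prod,
    integral_prod_symm]
  swap
  · exact (hmp.integrable_comp_emb (MeasurableEquiv.measurableEmbedding _)).2 hF
  let g : Fin m → ℝ → ℂ := fun j s =>
    h (i.succAbove j) s * if j = k then ∫ t in Iic s, h i t else 1
  have hg : ∀ u : Fin m → ℝ, ∫ x, indicator {t : Fin (m + 1) → ℝ | t i < t (i.succAbove k)}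
      (fun t => ∏ j, h j (t j))
      ((MeasurableEquiv.piFinSuccAbove (fun _ : Fin (m + 1) => ℝ) i).symm (x, u)) =
      ∏ j, g j (u j) := fun u => by
    have h1 : ∀ x, indicator {t : Fin (m + 1) → ℝ | t i < t (i.succAbove k)}
        (fun t => ∏ j, h j (t j))
        ((MeasurableEquiv.piFinSuccAbove (fun _ : Fin (m + 1) => ℝ) i).symm (x, u)) =
        (∏ j, h (i.succAbove j) (u j)) * (Iio (u k)).indicator (h i) x := fun x => by
      simp only [indicator_apply, mem_ofPred_eq, MeasurableEquiv.piFinSuccAbove_symm_apply,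
        Fin.insertNthEquiv_apply, Fin.insertNth_apply_same, Fin.insertNth_apply_succAbove,
        Fin.prod_univ_succAbove _ i, mem_Iio]
      split_ifs <;> ring
    simp_rw [h1, integral_const_mul, integral_indicator measurableSet_Iio]
    rw [← integral_Iic_eq_integral_Iio, Finset.prod_mul_distrib, Finset.prod_ite_eq' Finset.univ k]
    simp
  simp_rw [hg]
  rw [integral_fintype_prod_volume_eq_prod, ← Finset.mul_prod_erase _ _ (Finset.mem_univ k), mul_comm]
  congr 1
  · refine Finset.prod_congr rfl fun j hj => ?_
    simp [g, Finset.ne_of_mem_erase hj]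
  · simp [g]

theorem integral_comp_sub_div (g : ℝ → ℂ) (c η : ℝ) :
    ∫ t, g ((t - c) / η) = |η| • ∫ t, g t := by
  rw [integral_sub_right_eq_self (fun t => g (t / η)), Measure.integral_comp_div]

theorem norm_integral_dilate_mul_cexp (ψ : ℝ → ℂ) {η : ℝ} (hη : 0 < η) (c y : ℝ) :
    ‖∫ t, ψ ((t - c) / η) * cexp (2 * π * I * y * t)‖ =
      η * ‖∫ t, ψ t * cexp (2 * π * I * (η * y : ℝ) * t)‖ := by
  have h : ∀ t : ℝ, ψ ((t - c) / η) * cexp (2 * π * I * y * t) =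
      cexp (2 * π * I * y * c) *
        (fun t : ℝ => ψ t * cexp (2 * π * I * (η * y : ℝ) * t)) ((t - c) / η) := fun t => by
    have hη' : (η : ℂ) ≠ 0 := by exact_mod_cast hη.ne'
    rw [mul_left_comm, ← Complex.exp_add]
    congr 2
    push_cast
    field_simp
    ring
  simp_rw [h]
  rw [integral_const_mul,
    integral_comp_sub_div (fun t : ℝ => ψ t * cexp (2 * π * I * (η * y : ℝ) * t)), norm_mul,
    norm_cexp_two_pi, one_mul, norm_smul, Real.norm_eq_abs, abs_abs, abs_of_pos hη]

theorem eLpNorm_comp_sub_div {g : ℝ → ℂ} (hg : Continuous g) {η : ℝ} (hη : 0 < η) (c : ℝ)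
    {q : ℝ} (hq : 0 < q) :
    eLpNorm (fun t => g ((t - c) / η)) (ENNReal.ofReal q) volume =
      ENNReal.ofReal (η ^ (1 / q)) * eLpNorm g (ENNReal.ofReal q) volume := by
  have h1 : eLpNorm (fun t => g ((t - c) / η)) (ENNReal.ofReal q) volume =
      eLpNorm (fun t => g (t / η)) (ENNReal.ofReal q) volume :=
    eLpNorm_comp_measurePreserving (g := fun t => g (t / η)) (by fun_prop)
      (measurePreserving_sub_right volume c)
  have h2 : (fun t => g (t / η)) = g ∘ (fun t => η⁻¹ * t) := by
    ext t; simp [div_eq_inv_mul]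
  rw [h1, h2, ← eLpNorm_map_measure (by fun_prop) (by fun_prop),
    Real.map_volume_mul_left (inv_ne_zero hη.ne'), inv_inv, abs_of_pos hη,
    eLpNorm_smul_measure_of_ne_top ENNReal.ofReal_ne_top, ENNReal.toReal_div,
    ENNReal.toReal_one, ENNReal.toReal_ofReal hq.le, smul_eq_mul, ENNReal.ofReal_rpow_of_pos hη]

/-- A Schwartz function whose Fourier transform is an affine rescaling of `ψ`. -/
theorem exists_schwartz_fourier_eq_dilate {ψ : ℝ → ℂ} (hψ : ContDiff ℝ (⊤ : ℕ∞) ψ)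
    (hc : HasCompactSupport ψ) {η : ℝ} (hη : 0 < η) (c : ℝ) :
    ∃ f : SchwartzMap ℝ ℂ, HasCompactSupport (𝓕 ⇑f) ∧ 𝓕 ⇑f = fun t => ψ ((t - c) / η) := by
  have h1 : HasCompactSupport fun t => ψ ((t - c) / η) := by
    have := hc.comp_homeomorph ((Homeomorph.addRight (-c)).trans
      (Homeomorph.mulRight₀ η⁻¹ (inv_ne_zero hη.ne')))
    exact this
  have h2 : ContDiff ℝ (⊤ : ℕ∞) fun t => ψ ((t - c) / η) :=
    hψ.comp ((contDiff_id.sub contDiff_const).div_const η)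
  let f : SchwartzMap ℝ ℂ := 𝓕⁻ (h1.toSchwartzMap h2)
  have h3 : 𝓕 ⇑f = fun t => ψ ((t - c) / η) := by
    rw [← SchwartzMap.fourier_coe, FourierTransform.fourier_fourierInv_eq]
    rfl
  exact ⟨f, by rwa [h3], h3⟩

theorem continuous_integral_mul_cexp {ψ : ℝ → ℂ} (hψ : Integrable ψ) :
    Continuous fun y : ℝ => ∫ t, ψ t * cexp (2 * π * I * y * t) := by
  refine continuous_of_dominated (bound := fun t => ‖ψ t‖) (fun y => ?_) (fun y => ?_) hψ.norm ?_
  · exact hψ.aestronglyMeasurable.mul (continuous_cexp_two_pi y).aestronglyMeasurable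
  · exact ae_of_all _ fun t => by rw [norm_mul, norm_cexp_two_pi, mul_one]
  · exact ae_of_all _ fun t => by fun_prop

/-- Both the `L^p` norm and the Wiener norm of a function whose Fourier transform is a rescaling
of `ψ` by `η` are proportional to `η ^ (1 - 1 / p)`. -/
theorem exists_norm_le_of_fourier_eq_dilate {ψ : ℝ → ℂ} (hψ : ContDiff ℝ (⊤ : ℕ∞) ψ)
    (hc : HasCompactSupport ψ) {p : ℝ} (hp : 1 < p) (b : Bool) :
    ∃ K : ℝ, 0 ≤ K ∧ ∀ (η : ℝ) (c : ℝ) (f : SchwartzMap ℝ ℂ), 0 < η →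
      (𝓕 ⇑f = fun t => ψ ((t - c) / η)) →
      (if b then eLpNorm (𝓕 ⇑f) (ENNReal.ofReal (p / (p - 1))) volume
        else eLpNorm ⇑f (ENNReal.ofReal p) volume) ≤ ENNReal.ofReal (K * η ^ (1 - 1 / p)) := by
  have hp0 : 0 < p := by linarith
  have hq : 0 < p / (p - 1) := div_pos hp0 (by linarith)
  cases b with
  | true =>
    refine ⟨(eLpNorm ψ (ENNReal.ofReal (p / (p - 1))) volume).toReal, ENNReal.toReal_nonneg,
      fun η c f hη hf => ?_⟩
    have hfin : eLpNorm ψ (ENNReal.ofReal (p / (p - 1))) volume ≠ ⊤ :=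
      (hψ.continuous.memLp_of_hasCompactSupport hc).eLpNorm_ne_top
    rw [if_pos rfl, hf, eLpNorm_comp_sub_div hψ.continuous hη c hq,
      ENNReal.ofReal_mul ENNReal.toReal_nonneg, ENNReal.ofReal_toReal hfin, mul_comm,
      show 1 / (p / (p - 1)) = 1 - 1 / p by field_simp]
  | false =>
    obtain ⟨φ, -, hφ⟩ := exists_schwartz_fourier_eq_dilate hψ hc one_pos 0
    have hinv : ∀ (f : SchwartzMap ℝ ℂ) (x : ℝ), f x = ∫ t : ℝ, 𝓕 (⇑f) t * cexp (2 * π * I * x * t) := by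
      intro f x
      have h : (𝓕⁻ (𝓕 f : SchwartzMap ℝ ℂ) : SchwartzMap ℝ ℂ) x = f x := by
        rw [FourierTransform.fourierInv_fourier_eq]
      simp only [SchwartzMap.fourierInv_coe, SchwartzMap.fourier_coe] at h
      rw [← h, Real.fourierInv_eq']
      refine integral_congr_ae (ae_of_all _ fun t => ?_)
      simp only [smul_eq_mul]
      rw [mul_comm]
      congr 2
      simp
      ring
    refine ⟨(eLpNorm φ (ENNReal.ofReal p) volume).toReal, ENNReal.toReal_nonneg,
      fun η c f hη hf => ?_⟩
    have hfin : eLpNorm φ (ENNReal.ofReal p) volume ≠ ⊤ := (φ.memLp _ _).eLpNorm_ne_top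
    have hnorm : ∀ x, ‖f x‖ = ‖(η : ℂ) * φ ((x - 0) / η⁻¹)‖ := fun x => by
      rw [hinv f, hinv φ, hf, hφ, norm_integral_dilate_mul_cexp ψ hη, norm_mul,
        norm_integral_dilate_mul_cexp ψ one_pos, norm_real, Real.norm_of_nonneg hη.le]
      simp [mul_comm]
    rw [if_neg (by simp), eLpNorm_congr_norm_ae (ae_of_all _ hnorm)]
    have h := eLpNorm_const_smul (η : ℂ) (fun x => φ ((x - 0) / η⁻¹)) (ENNReal.ofReal p) volume
    rw [eLpNorm_comp_sub_div φ.continuous (inv_pos.2 hη) 0 hp0] at h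
    refine (le_of_eq h).trans (le_of_eq ?_)
    rw [ENNReal.ofReal_mul ENNReal.toReal_nonneg, ENNReal.ofReal_toReal hfin, ← mul_assoc,
      mul_comm (eLpNorm _ _ _)]
    congr 1
    rw [← ofReal_norm, norm_real, Real.norm_of_nonneg hη.le, ← ENNReal.ofReal_mul hη.le,
      Real.inv_rpow hη.le, Real.rpow_sub hη, Real.rpow_one, div_eq_mul_inv η]

theorem exists_bump_integral_ne_zero : ∃ ψ : ℝ → ℂ, ContDiff ℝ (⊤ : ℕ∞) ψ ∧ HasCompactSupport ψ ∧
    (∀ t, ψ t ≠ 0 → |t| ≤ 1) ∧ ∫ t, ψ t ≠ 0 ∧ ∫ t, ψ t * ψ t ≠ 0 := by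
  let b : ContDiffBump (0 : ℝ) := ⟨1 / 2, 1, by norm_num, by norm_num⟩
  have hb : Continuous b := b.continuous
  have h0 : b 0 ≠ 0 := by
    rw [b.one_of_mem_closedBall (by simp [b])]
    exact one_ne_zero
  refine ⟨fun t => (b t : ℂ), ofRealCLM.contDiff.comp b.contDiff,
    b.hasCompactSupport.comp_left ofReal_zero, fun t ht => ?_, ?_, ?_⟩
  · have h : t ∈ Function.support b := by simpa using ht
    rw [b.support_eq, Metric.mem_ball, dist_zero_right] at h
    exact h.le
  · beta_reduce
    rw [integral_complex_ofReal, ofReal_ne_zero]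
    exact (hb.integral_pos_of_hasCompactSupport_nonneg_nonzero b.hasCompactSupport
      (fun t => b.nonneg) h0).ne'
  · simp_rw [← ofReal_mul]
    rw [integral_complex_ofReal, ofReal_ne_zero]
    exact ((hb.mul hb).integral_pos_of_hasCompactSupport_nonneg_nonzero
      b.hasCompactSupport.mul_right (fun t => mul_nonneg b.nonneg b.nonneg)
      (mul_ne_zero h0 h0)).ne'

/-- Frequency centers spaced by `4`, except that those of index `k` and `k + 1` coincide at `0`. -/
noncomputable def freqCenter (k j : ℕ) : ℝ := 4 * ((if j ≤ k then j else j - 1 : ℕ) - k : ℝ)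

theorem strictMono_of_near_freqCenter {m : ℕ} (k : Fin m) {t : Fin (m + 1) → ℝ}
    (ht : ∀ j : Fin (m + 1), |t j - freqCenter k j| ≤ 1) (hk : t k.castSucc < t k.succ) :
    StrictMono t := by
  rw [Fin.strictMono_iff_lt_succ]
  intro j
  rcases eq_or_ne j k with rfl | hjk
  · exact hk
  · have hjk' : (j : ℕ) ≠ k := fun h => hjk (Fin.ext h)
    have h1 := abs_le.1 (ht j.castSucc)
    have h2 := abs_le.1 (ht j.succ)
    have h3 : freqCenter k j.succ = freqCenter k j.castSucc + 4 := by
      simp only [freqCenter, Fin.val_succ, Fin.val_castSucc]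
      rcases lt_or_gt_of_ne hjk' with h | h
      · rw [if_pos (by omega), if_pos (by omega)]
        push_cast
        ring
      · obtain ⟨l, hl⟩ : ∃ l, (j : ℕ) = l + 1 := ⟨j - 1, by omega⟩
        rw [if_neg (by omega), if_neg (by omega), hl]
        push_cast [Nat.add_sub_cancel]
        ring
    linarith [h1.2, h2.1]

theorem norm_Cop_of_fourier_eq_dilate {ψ : ℝ → ℂ} (hψ : ContDiff ℝ (⊤ : ℕ∞) ψ)
    (hc : HasCompactSupport ψ) (hsupp : ∀ t, ψ t ≠ 0 → |t| ≤ 1) {m : ℕ} (k : Fin m)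
    (ε η : Fin (m + 1) → ℝ) (hη : ∀ j, 0 < η j) (hη1 : ∀ j, η j ≤ 1)
    (hk : η k.castSucc = 1) (hk' : η k.succ = 1) (f : Fin (m + 1) → ℝ → ℂ)
    (hf : ∀ j : Fin (m + 1), 𝓕 (f j) = fun t => ψ ((t - freqCenter k j) / η j)) (x : ℝ) :
    ‖Cop ε f x‖ = (∏ j ∈ Finset.univ.erase k, (η (k.castSucc.succAbove j) *
        ‖∫ t, ψ t * cexp (2 * π * I * (η (k.castSucc.succAbove j) *
          (ε (k.castSucc.succAbove j) * x) : ℝ) * t)‖)) *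
      ‖∫ s, ψ s * cexp (2 * π * I * (ε k.succ * x : ℝ) * s) *
        ∫ t in Iic s, ψ t * cexp (2 * π * I * (ε k.castSucc * x : ℝ) * t)‖ := by
  let h : Fin (m + 1) → ℝ → ℂ := fun j t =>
    ψ ((t - freqCenter k j) / η j) * cexp (2 * π * I * (ε j * x : ℝ) * t)
  have hI : ∀ j, Integrable (h j) := fun j => by
    obtain ⟨φ, hφc, hφ⟩ := exists_schwartz_fourier_eq_dilate hψ hc (hη j) (freqCenter k j)
    rw [hφ] at hφc
    refine Continuous.integrable_of_hasCompactSupport ?_ hφc.mul_right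
    exact (hψ.continuous.comp (by fun_prop)).mul (continuous_cexp_two_pi _)
  have hcop : Cop ε f x = ∫ t in {t : Fin (m + 1) → ℝ | StrictMono t}, ∏ j, h j (t j) := by
    refine integral_congr_ae (ae_of_all _ fun t => ?_)
    simp only [h, hf, Finset.prod_mul_distrib, ← Complex.exp_sum]
    congr 2
    rw [ofReal_sum, Finset.mul_sum]
    refine Finset.sum_congr rfl fun j _ => ?_
    push_cast
    ring
  have hset : ∫ t in {t : Fin (m + 1) → ℝ | t k.castSucc < t k.succ}, ∏ j, h j (t j) =
      ∫ t in {t : Fin (m + 1) → ℝ | StrictMono t}, ∏ j, h j (t j) := by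
    refine setIntegral_eq_of_subset_of_forall_sdiff_eq_zero
      (measurableSet_lt (measurable_pi_apply _) (measurable_pi_apply _))
      (fun t ht => ht (Fin.castSucc_lt_succ)) fun t ht => ?_
    by_contra hne
    refine ht.2 (strictMono_of_near_freqCenter k (fun j => ?_) ht.1)
    have h1 : ψ ((t j - freqCenter k j) / η j) ≠ 0 :=
      left_ne_zero_of_mul (Finset.prod_ne_zero_iff.1 hne j (Finset.mem_univ j))
    have h2 := hsupp _ h1
    rw [abs_div, abs_of_pos (hη j), div_le_one (hη j)] at h2
    exact h2.trans (hη1 j)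
  have hsa : k.castSucc.succAbove k = k.succ := Fin.succAbove_castSucc_self k
  have hfub := setIntegral_lt_prod hI k.castSucc k
  rw [hsa] at hfub
  rw [hcop, ← hset, hfub, norm_mul, norm_prod]
  congr 1
  · exact Finset.prod_congr rfl fun j _ => norm_integral_dilate_mul_cexp ψ (hη _) _ _
  · have h0 : freqCenter k k.castSucc = 0 := by simp [freqCenter]
    have h1 : freqCenter k k.succ = 0 := by simp [freqCenter]
    simp only [h, h0, h1, hk, hk', sub_zero, div_one]

theorem volume_sign_mul_mem_Ioo {e : ℝ} (he : e = 1 ∨ e = -1) (a b : ℝ) :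
    volume {x : ℝ | e * x ∈ Ioo a b} = ENNReal.ofReal (b - a) := by
  have h : {x : ℝ | e * x ∈ Ioo a b} = (fun x => e * x) ⁻¹' Ioo a b := rfl
  rw [h, Real.volume_preimage_mul_left (by rcases he with rfl | rfl <;> norm_num), Real.volume_Ioo]
  rcases he with rfl | rfl <;> simp

/-- A function of size at least `A` on an interval of length `L` has `L^{1/S}` quasi-norm at least
`A * L ^ S`. -/
theorem le_eLpNorm_of_le_on_sign_Ioo {g : ℝ → ℂ} {e : ℝ} (he : e = 1 ∨ e = -1) {a b A S : ℝ}
    (hab : a ≤ b) (hA : 0 ≤ A) (hS : 0 < S) (hg : ∀ x, e * x ∈ Ioo a b → A ≤ ‖g x‖) :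
    ENNReal.ofReal (A * (b - a) ^ S) ≤ eLpNorm g (ENNReal.ofReal (1 / S)) volume := by
  have hms : MeasurableSet {x : ℝ | e * x ∈ Ioo a b} :=
    measurableSet_Ioo.preimage (measurable_const_mul e)
  have h1 := eLpNorm_indicator_const (μ := volume) (c := A) (p := ENNReal.ofReal (1 / S)) hms
    (by simpa using hS) ENNReal.ofReal_ne_top
  rw [volume_sign_mul_mem_Ioo he, ENNReal.toReal_ofReal (by positivity), one_div_one_div,
    ENNReal.ofReal_rpow_of_nonneg (by linarith) hS.le, ← ofReal_norm, Real.norm_of_nonneg hA,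
    ← ENNReal.ofReal_mul hA] at h1
  rw [← h1]
  refine eLpNorm_mono fun x => ?_
  by_cases hx : e * x ∈ Ioo a b
  · rw [indicator_of_mem (by exact hx), Real.norm_of_nonneg hA]
    exact hg x hx
  · rw [indicator_of_notMem (by exact hx), norm_zero]
    exact norm_nonneg _

theorem exists_norm_ordered_pairing_ge {ψ : ℝ → ℂ} (hψ : ContDiff ℝ 1 ψ)
    (hc : HasCompactSupport ψ) (h0 : ∫ s, ψ s * ψ s ≠ 0) :
    ∃ c Y : ℝ, 0 < c ∧ 0 < Y ∧ ∀ y, Y ≤ y → c / y ≤ ‖∫ s, ψ s * cexp (2 * π * I * (-y : ℝ) * s) *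
      ∫ t in Iic s, ψ t * cexp (2 * π * I * y * t)‖ := by
  have hpos : 0 < ‖∫ s, ψ s * ψ s‖ := norm_pos_iff.2 h0
  obtain ⟨Y, hY⟩ := eventually_atTop.1
    ((tendsto_two_pi_mul_ordered_pairing hψ hc).norm.eventually_const_le (half_lt_self hpos))
  refine ⟨‖∫ s, ψ s * ψ s‖ / 2 / (2 * π), max Y 1, by positivity, by positivity, fun y hy => ?_⟩
  have hy0 : 0 < y := lt_of_lt_of_le one_pos ((le_max_right _ _).trans hy)
  have h := hY y ((le_max_left _ _).trans hy)
  rw [norm_mul, show ‖2 * π * I * y‖ = 2 * π * y by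
    simp [abs_of_pos hy0, abs_of_pos Real.pi_pos]] at h
  rw [div_div, div_le_iff₀ (by positivity)]
  linarith

theorem exists_norm_integral_mul_cexp_ge {ψ : ℝ → ℂ} (hψ : Integrable ψ) (h0 : ∫ t, ψ t ≠ 0) :
    ∃ c δ : ℝ, 0 < c ∧ 0 < δ ∧
      ∀ y : ℝ, |y| < δ → c ≤ ‖∫ t, ψ t * cexp (2 * π * I * y * t)‖ := by
  have hpos : 0 < ‖∫ t, ψ t‖ := norm_pos_iff.2 h0
  have hlim := ((continuous_integral_mul_cexp hψ).tendsto 0).norm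
  simp only [ofReal_zero, mul_zero, zero_mul, Complex.exp_zero, mul_one] at hlim
  obtain ⟨δ, hδ, h⟩ := Metric.eventually_nhds_iff.1
    (hlim.eventually_const_le (half_lt_self hpos))
  exact ⟨_, δ, half_pos hpos, hδ, fun y hy => h (by simpa using hy)⟩

/-- if at some sign degeneracy `ε_i = -ε_{i+1}` one has
`X^i = W_{p_i}`, `X^{i+1} = L^{p_{i+1}}` and `1/p_i + 1/p_{i+1} > 1`, then `C_n^ε`
is not bounded from `X¹ × ⋯ × Xⁿ` into `L^{1/(Σ 1/p_j)}`.  Here `Wsp j = true`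
means `X^j = W_{p_j}`. -/
theorem stmt14 (n : ℕ) (hn : 2 ≤ n) (ε : Fin n → ℝ) (hε : ∀ j, ε j = 1 ∨ ε j = -1)
    (p : Fin n → ℝ) (hp : ∀ j, 1 < p j) (Wsp : Fin n → Bool)
    (i : ℕ) (hi : i + 1 < n)
    (hsum : 1 < 1 / p ⟨i, by omega⟩ + 1 / p ⟨i + 1, hi⟩)
    (hdeg : ε ⟨i, by omega⟩ = -ε ⟨i + 1, hi⟩)
    (hWi : Wsp ⟨i, by omega⟩ = true) (hLi : Wsp ⟨i + 1, hi⟩ = false)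
    (C : ℝ) (hC : 0 < C) :
    ∃ f : Fin n → SchwartzMap ℝ ℂ,
      (∀ j, HasCompactSupport (𝓕 ⇑(f j))) ∧
      ENNReal.ofReal C *
          ∏ j, (if Wsp j then eLpNorm (𝓕 ⇑(f j)) (ENNReal.ofReal (p j / (p j - 1))) volume
                else eLpNorm ⇑(f j) (ENNReal.ofReal (p j)) volume) <
        eLpNorm (Cop ε (fun j => ⇑(f j))) (ENNReal.ofReal (1 / ∑ j, 1 / p j)) volume := by
  obtain ⟨m, rfl⟩ : ∃ m, n = m + 1 := ⟨n - 1, by omega⟩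
  obtain ⟨k, hki⟩ : ∃ k : Fin m, (k : ℕ) = i := ⟨⟨i, by omega⟩, rfl⟩
  subst hki
  change 1 < 1 / p k.castSucc + 1 / p k.succ at hsum
  change ε k.castSucc = -ε k.succ at hdeg
  have hp0 : ∀ j, 0 < p j := fun j => one_pos.trans (hp j)
  obtain ⟨ψ, hψ, hc, hsupp, hI, hψsq⟩ := exists_bump_integral_ne_zero
  obtain ⟨b, Y, hb, hY, hB⟩ :=
    exists_norm_ordered_pairing_ge (hψ.of_le (by exact_mod_cast le_top)) hc hψsq
  obtain ⟨a, δ, ha, hδ, hΦ⟩ := exists_norm_integral_mul_cexp_ge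
    (hψ.continuous.integrable_of_hasCompactSupport hc) hI
  choose K hK0 hK using fun j => exists_norm_le_of_fourier_eq_dilate hψ hc (hp j) (Wsp j)
  set S := ∑ j, 1 / p j with hS
  set θ := 1 / p k.castSucc + 1 / p k.succ
  have hsa : k.castSucc.succAbove k = k.succ := Fin.succAbove_castSucc_self k
  have hSsplit : S = θ + ∑ j ∈ Finset.univ.erase k, 1 / p (k.castSucc.succAbove j) := by
    rw [hS, Fin.sum_univ_succAbove _ k.castSucc, ← Finset.add_sum_erase _ _ (Finset.mem_univ k), hsa,
      ← add_assoc]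
  have hS0 : 0 < S := by
    rw [hSsplit]
    have : 0 ≤ ∑ j ∈ Finset.univ.erase k, 1 / p (k.castSucc.succAbove j) :=
      Finset.sum_nonneg fun j _ => (one_div_pos.2 (hp0 _)).le
    linarith
  set D := a ^ (Finset.univ.erase k).card * (b / δ) * (δ / 2) ^ S with hD
  have hD0 : 0 < D := by positivity
  obtain ⟨R, hRbig, hR1, hRY⟩ : ∃ R : ℝ, C * ∏ j, K j < D * R ^ (θ - 1) ∧ 1 ≤ R ∧ 2 * Y / δ ≤ R :=
    ((((tendsto_rpow_atTop (sub_pos.2 hsum)).const_mul_atTop hD0).eventually_gt_atTop _).and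
      ((eventually_ge_atTop 1).and (eventually_ge_atTop _))).exists
  have hR0 : 0 < R := one_pos.trans_le hR1
  let η : Fin (m + 1) → ℝ := fun j => if j = k.castSucc ∨ j = k.succ then 1 else R⁻¹
  have hη : ∀ j, 0 < η j := fun j => by
    simp only [η]; split_ifs <;> positivity
  have hη1 : ∀ j, η j ≤ 1 := fun j => by
    simp only [η]; split_ifs
    exacts [le_rfl, inv_le_one_of_one_le₀ hR1]
  have hηk : η k.castSucc = 1 := by simp [η]
  have hηk' : η k.succ = 1 := by simp [η]
  have hηj : ∀ j ∈ Finset.univ.erase k, η (k.castSucc.succAbove j) = R⁻¹ := fun j hj => by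
    refine if_neg ?_
    rw [not_or]
    refine ⟨Fin.succAbove_ne _ _, fun h => Finset.ne_of_mem_erase hj ?_⟩
    rw [← hsa] at h
    exact Fin.succAbove_right_injective h
  have hprod : ∀ g : Fin (m + 1) → ℝ, g k.castSucc = 1 → g k.succ = 1 →
      ∏ j, g j = ∏ j ∈ Finset.univ.erase k, g (k.castSucc.succAbove j) := fun g h h' => by
    rw [Fin.prod_univ_succAbove _ k.castSucc, h, one_mul,
      ← Finset.mul_prod_erase _ _ (Finset.mem_univ k), hsa, h', one_mul]
  have hηprod := hprod η hηk hηk'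
  have hPpos : 0 < ∏ j, η j := Finset.prod_pos fun j _ => hη j
  have hηrpow : ∏ j, η j ^ (1 - 1 / p j) = (∏ j, η j) * R ^ (S - θ) := by
    rw [hprod (fun j => η j ^ (1 - 1 / p j)) (by simp [hηk]) (by simp [hηk']), hηprod,
      show S - θ = ∑ j ∈ Finset.univ.erase k, 1 / p (k.castSucc.succAbove j) by
        rw [hSsplit]; ring,
      Real.rpow_sum_of_pos hR0, ← Finset.prod_mul_distrib]
    refine Finset.prod_congr rfl fun j hj => ?_
    rw [hηj j hj, Real.rpow_sub (by positivity), Real.rpow_one, Real.inv_rpow hR0.le, div_inv_eq_mul]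
  choose f hfc hf using fun j : Fin (m + 1) =>
    exists_schwartz_fourier_eq_dilate hψ hc (hη j) (freqCenter k j)
  refine ⟨f, hfc, ?_⟩
  have hupper : ENNReal.ofReal C *
      ∏ j, (if Wsp j then eLpNorm (𝓕 ⇑(f j)) (ENNReal.ofReal (p j / (p j - 1))) volume
        else eLpNorm ⇑(f j) (ENNReal.ofReal (p j)) volume) ≤
      ENNReal.ofReal (C * ((∏ j, K j) * ((∏ j, η j) * R ^ (S - θ)))) := by
    rw [ENNReal.ofReal_mul hC.le, ← hηrpow, ← Finset.prod_mul_distrib, ENNReal.ofReal_prod_of_nonneg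
      fun j _ => mul_nonneg (hK0 j) (Real.rpow_nonneg (hη j).le _)]
    gcongr with j
    exact hK j (η j) _ (f j) (hη j) (hf j)
  have hpt : ∀ x, ε k.castSucc * x ∈ Ioo (R * (δ / 2)) (R * δ) →
      (∏ j, η j) * a ^ (Finset.univ.erase k).card * (b / (R * δ)) ≤
        ‖Cop ε (fun j => ⇑(f j)) x‖ := fun x hx => by
    have habs : ∀ j, |ε j * x| = |ε k.castSucc * x| := fun j => by
      rw [abs_mul, abs_mul]
      rcases hε j with h | h <;> rcases hε k.castSucc with h' | h' <;> simp [h, h']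
    have hx0 : 0 < ε k.castSucc * x := (by positivity : 0 < R * (δ / 2)).trans hx.1
    rw [norm_Cop_of_fourier_eq_dilate hψ hc hsupp k ε η hη hη1 hηk hηk' _ hf]
    refine mul_le_mul ?_ ?_ (by positivity)
      (Finset.prod_nonneg fun j _ => mul_nonneg (hη _).le (norm_nonneg _))
    · rw [hηprod, ← Finset.prod_const, ← Finset.prod_mul_distrib]
      refine Finset.prod_le_prod (fun j _ => mul_nonneg (hη _).le ha.le) fun j hj => ?_
      refine mul_le_mul_of_nonneg_left (hΦ _ ?_) (hη _).le
      rw [abs_mul, habs, abs_of_pos hx0, hηj j hj, abs_of_pos (inv_pos.2 hR0),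
        inv_mul_lt_iff₀ hR0]
      exact hx.2
    · have hYx : Y ≤ ε k.castSucc * x := by
        refine le_trans ?_ hx.1.le
        rw [div_le_iff₀ hδ] at hRY
        linarith
      have h := hB _ hYx
      rw [show -(ε k.castSucc * x) = ε k.succ * x by rw [hdeg]; ring] at h
      refine le_trans ?_ h
      exact div_le_div_of_nonneg_left hb.le hx0 hx.2.le
  have hlower := le_eLpNorm_of_le_on_sign_Ioo (hε k.castSucc)
    (mul_le_mul_of_nonneg_left (half_le_self hδ.le) hR0.le) (by positivity) hS0 hpt
  refine hupper.trans_lt (lt_of_lt_of_le ?_ hlower)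
  rw [ENNReal.ofReal_lt_ofReal_iff (by
    rw [show R * δ - R * (δ / 2) = R * (δ / 2) by ring]; positivity)]
  have hpow : R ^ S = R * (R ^ (S - θ) * R ^ (θ - 1)) := by
    rw [← Real.rpow_add hR0, ← Real.rpow_one_add' hR0.le (by linarith)]
    congr 1
    ring
  calc C * ((∏ j, K j) * ((∏ j, η j) * R ^ (S - θ)))
      = (C * ∏ j, K j) * ((∏ j, η j) * R ^ (S - θ)) := by ring
    _ < D * R ^ (θ - 1) * ((∏ j, η j) * R ^ (S - θ)) :=
      mul_lt_mul_of_pos_right hRbig (by positivity)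
    _ = _ := by
      rw [show R * δ - R * (δ / 2) = R * (δ / 2) by ring, Real.mul_rpow hR0.le (by positivity),
        hpow, hD]
      field_simp
end

section
/- (Biparameter Menshov–Zygmund–Carleson estimate.) Let p > 2. Then there is a constant C_p such that for every Schwartz function f on ℝ², ‖ sup_{(a,b) ∈ ℝ²} | ∫_{x < a} ∫_{y < b} f̂(x,y) e^{2πi(ξ_1 x + ξ_2 y)} dx dy | ‖_{L^p_{(ξ_1,ξ_2)}(ℝ²)} ≤ C_p ‖f̂‖_{L^{p′}(ℝ²)}. -/
open MeasureTheory Complex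
open scoped Real ENNReal

/-- The two-dimensional Fourier transform on `ℝ²`. -/
noncomputable def FT2 (f : ℝ × ℝ → ℂ) (ξ : ℝ × ℝ) : ℂ :=
  ∫ x : ℝ × ℝ, f x * Complex.exp (-(2 * π * Complex.I * (x.1 * ξ.1 + x.2 * ξ.2)))

/-- The inductive step for `christKiselev_finset`: a threshold splitting `E` into
two parts of at most half the mass. -/
lemma exists_half_threshold {X : Type*} [MeasurableSpace X] (ν : Measure X) [IsFiniteMeasure ν]
    {φ : X → ℝ} (hφ : Measurable φ) {A : Finset ℝ} (hA : A.Nonempty) (E : Set X) :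
    ∃ m ∈ A, (∀ a ∈ A, a < m → ν (E ∩ {x | φ x < a}) ≤ ν E / 2) ∧
      ((∀ a ∈ A, a ≤ m) ∨ ν (E ∩ {x | m ≤ φ x}) ≤ ν E / 2) := by
  classical
  set B := A.filter fun a => ν E / 2 ≤ ν (E ∩ {x | φ x < a}) with hB
  by_cases hne : B.Nonempty
  · have hmem := Finset.min'_mem B hne
    set m := B.min' hne
    rw [hB, Finset.mem_filter] at hmem
    refine ⟨m, hmem.1, fun a ha ham => ?_, Or.inr ?_⟩
    · by_contra! hlt
      exact absurd (Finset.min'_le B a (Finset.mem_filter.2 ⟨ha, hlt.le⟩)) (not_le.2 ham)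
    · have hsplit : ν (E ∩ {x | φ x < m}) + ν (E ∩ {x | m ≤ φ x}) = ν E := by
        rw [← measure_inter_add_sdiff E (measurableSet_lt hφ measurable_const : MeasurableSet
          {x | φ x < m})]
        congr 2
        ext x
        simp
      have h2 : ν E / 2 + ν (E ∩ {x | m ≤ φ x}) ≤ ν E / 2 + ν E / 2 := by
        rw [ENNReal.add_halves, ← hsplit]
        gcongr
        rw [hsplit]
        exact hmem.2
      exact (ENNReal.add_le_add_iff_left
        (ENNReal.div_lt_top (measure_ne_top ν E) two_ne_zero).ne).1 h2
  · refine ⟨A.max' hA, A.max'_mem hA, fun a ha _ => ?_, Or.inl fun a ha => A.le_max' a ha⟩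
    by_contra! hlt
    exact hne ⟨a, Finset.mem_filter.2 ⟨ha, hlt.le⟩⟩

/-- The Christ–Kiselev maximal inequality for a subadditive set function `S` with values in
nonnegative functions. -/
theorem christKiselev_finset {X Y : Type*} [MeasurableSpace X] [MeasurableSpace Y]
    (ν : Measure X) [IsFiniteMeasure ν] (μ : Measure Y) {p τ : ℝ} (hp : 1 ≤ p) (hτ : 1 / p < τ)
    {S : Set X → Y → ℝ≥0∞} {C : ℝ≥0∞}
    (hS : ∀ E, MeasurableSet E → Measurable (S E))
    (hsub : ∀ E F, MeasurableSet E → MeasurableSet F → Disjoint E F →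
      ∀ y, S (E ∪ F) y ≤ S E y + S F y)
    (hbd : ∀ E, MeasurableSet E → (∫⁻ y, S E y ^ p ∂μ) ^ (1 / p) ≤ C * ν E ^ τ)
    {φ : X → ℝ} (hφ : Measurable φ) (A : Finset ℝ) :
    ∀ E, MeasurableSet E →
      (∫⁻ y, (A.sup fun a => S (E ∩ {x | φ x < a}) y) ^ p ∂μ) ^ (1 / p) ≤
        ENNReal.ofReal (1 - 2 ^ (1 / p - τ))⁻¹ * C * ν E ^ τ := by
  classical
  have hp0 : 0 < p := by linarith
  have hp' : 0 < 1 / p := by positivity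
  have hτ0 : 0 < τ := hp'.trans hτ
  set d : ℝ := 2 ^ (1 / p - τ) with hd
  have hd0 : 0 < d := by positivity
  have hd1 : d < 1 := Real.rpow_lt_one_of_one_lt_of_neg (by norm_num) (by linarith)
  set K : ℝ := (1 - d)⁻¹ with hK
  have hK0 : 0 < K := inv_pos.2 (by linarith)
  have hKd : 1 + K * d = K := by
    rw [hK]; field_simp [show (1 - d) ≠ 0 by linarith]; ring
  have hlt (a : ℝ) : MeasurableSet {x | φ x < a} := measurableSet_lt hφ measurable_const
  induction A using Finset.strongInduction with
  | H A ih =>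
  intro E hE
  rcases A.eq_empty_or_nonempty with rfl | hA
  · simp [ENNReal.zero_rpow_of_pos, hp0]
  obtain ⟨m, hmA, hleft, hright⟩ := exists_half_threshold ν hφ hA E
  set L := A.filter (· < m) with hL
  set R := A.filter (m < ·) with hR
  have hLA : L ⊂ A := Finset.filter_ssubset.2 ⟨m, hmA, lt_irrefl m⟩
  have hRA : R ⊂ A := Finset.filter_ssubset.2 ⟨m, hmA, lt_irrefl m⟩
  set E₂ := E ∩ {x | m ≤ φ x} with hE₂
  have hE₂m : MeasurableSet E₂ := hE.inter (measurableSet_le measurable_const hφ)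
  set u : Y → ℝ≥0∞ := fun y => S (E ∩ {x | φ x < m}) y with hu
  set l : Y → ℝ≥0∞ := fun y => L.sup fun a => S (E ∩ {x | φ x < a}) y with hl
  set r : Y → ℝ≥0∞ := fun y => R.sup fun a => S (E₂ ∩ {x | φ x < a}) y with hr
  have hum : Measurable u := hS _ (hE.inter (hlt m))
  have hlm : Measurable l := by
    simp only [hl, Finset.sup_eq_iSup]
    exact .biSup _ L.countable_toSet fun a _ => hS _ (hE.inter (hlt a))
  have hrm : Measurable r := by
    simp only [hr, Finset.sup_eq_iSup]
    exact .biSup _ R.countable_toSet fun a _ => hS _ (hE₂m.inter (hlt a))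
  set D : ℝ≥0∞ := ENNReal.ofReal K * C * (ν E / 2) ^ τ with hD
  have hlD : (∫⁻ y, l y ^ p ∂μ) ^ (1 / p) ≤ D := by
    rcases L.eq_empty_or_nonempty with h0 | hne
    · simp [hl, h0, ENNReal.zero_rpow_of_pos, hp0]
    have hmax := Finset.max'_mem L hne
    set M := L.max' hne with hM
    have hmax' := Finset.mem_filter.1 hmax
    have key := ih L hLA (E ∩ {x | φ x < M}) (hE.inter (hlt M))
    have hcongr : ∀ y, (L.sup fun a => S (E ∩ {x | φ x < M} ∩ {x | φ x < a}) y) = l y := by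
      intro y
      refine Finset.sup_congr rfl fun a ha => ?_
      have haM : a ≤ M := L.le_max' a ha
      congr 1
      ext x
      simp only [Set.mem_inter_iff, Set.mem_ofPred_eq]
      constructor
      · rintro ⟨⟨h1, _⟩, h2⟩; exact ⟨h1, h2⟩
      · rintro ⟨h1, h2⟩; exact ⟨⟨h1, h2.trans_le haM⟩, h2⟩
    simp only [hcongr] at key
    refine key.trans ?_
    rw [hD]
    gcongr
    exact hleft M hmax'.1 hmax'.2
  have hrD : (∫⁻ y, r y ^ p ∂μ) ^ (1 / p) ≤ D := by
    rcases hright with hall | hhalf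
    · have h0 : R = ∅ := by
        rw [hR, Finset.filter_eq_empty_iff]
        exact fun a ha => not_lt.2 (hall a ha)
      simp [hr, h0, ENNReal.zero_rpow_of_pos, hp0]
    · refine (ih R hRA E₂ hE₂m).trans ?_
      rw [hD]
      gcongr
  have hpt : ∀ y, (A.sup fun a => S (E ∩ {x | φ x < a}) y) ≤ (u + (l ⊔ r)) y := by
    intro y
    refine Finset.sup_le fun a ha => ?_
    simp only [Pi.add_apply, Pi.sup_apply]
    rcases lt_trichotomy a m with h | h | h
    · have : S (E ∩ {x | φ x < a}) y ≤ l y :=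
        Finset.le_sup (f := fun a => S (E ∩ {x | φ x < a}) y) (Finset.mem_filter.2 ⟨ha, h⟩)
      exact this.trans (le_sup_left.trans le_add_self)
    · subst h
      exact le_self_add
    · have h1 : E ∩ {x | φ x < a} = (E ∩ {x | φ x < m}) ∪ (E₂ ∩ {x | φ x < a}) := by
        ext x
        simp only [hE₂, Set.mem_inter_iff, Set.mem_ofPred_eq, Set.mem_union]
        constructor
        · rintro ⟨h1, h2⟩
          rcases lt_or_ge (φ x) m with h3 | h3
          · exact Or.inl ⟨h1, h3⟩
          · exact Or.inr ⟨⟨h1, h3⟩, h2⟩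
        · rintro (⟨h1, h2⟩ | ⟨⟨h1, _⟩, h2⟩)
          · exact ⟨h1, h2.trans h⟩
          · exact ⟨h1, h2⟩
      have hdisj : Disjoint (E ∩ {x | φ x < m}) (E₂ ∩ {x | φ x < a}) := by
        rw [Set.disjoint_left]
        simp only [hE₂, Set.mem_inter_iff, Set.mem_ofPred_eq]
        rintro x ⟨_, h1⟩ ⟨⟨_, h2⟩, _⟩
        exact absurd h1 (not_lt.2 h2)
      rw [h1]
      refine (hsub _ _ (hE.inter (hlt m)) (hE₂m.inter (hlt a)) hdisj y).trans ?_
      have : S (E₂ ∩ {x | φ x < a}) y ≤ r y :=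
        Finset.le_sup (f := fun a => S (E₂ ∩ {x | φ x < a}) y) (Finset.mem_filter.2 ⟨ha, h⟩)
      gcongr
      exact this.trans le_sup_right
  have hpow {z : Y → ℝ≥0∞} (hz : (∫⁻ y, z y ^ p ∂μ) ^ (1 / p) ≤ D) :
      ∫⁻ y, z y ^ p ∂μ ≤ D ^ p := by
    rw [one_div] at hz
    exact (ENNReal.rpow_inv_le_iff hp0).1 hz
  have hlr : (∫⁻ y, (l ⊔ r) y ^ p ∂μ) ^ (1 / p) ≤ 2 ^ (1 / p) * D := by
    have h1 : ∫⁻ y, (l ⊔ r) y ^ p ∂μ ≤ 2 * D ^ p := by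
      calc ∫⁻ y, (l ⊔ r) y ^ p ∂μ ≤ ∫⁻ y, (l y ^ p + r y ^ p) ∂μ := by
            refine lintegral_mono fun y => ?_
            rcases le_total (l y) (r y) with h | h
            · simp [Pi.sup_apply, sup_eq_right.2 h]
            · simp [Pi.sup_apply, sup_eq_left.2 h]
        _ = (∫⁻ y, l y ^ p ∂μ) + ∫⁻ y, r y ^ p ∂μ :=
            lintegral_add_left (hlm.pow_const p) _
        _ ≤ D ^ p + D ^ p := add_le_add (hpow hlD) (hpow hrD)
        _ = 2 * D ^ p := (two_mul _).symm
    calc (∫⁻ y, (l ⊔ r) y ^ p ∂μ) ^ (1 / p) ≤ (2 * D ^ p) ^ (1 / p) := by gcongr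
      _ = 2 ^ (1 / p) * D := by
        rw [ENNReal.mul_rpow_of_nonneg _ _ hp'.le, ← ENNReal.rpow_mul, mul_one_div_cancel hp0.ne',
          ENNReal.rpow_one]
  have hD2 : 2 ^ (1 / p) * D = ENNReal.ofReal (K * d) * C * ν E ^ τ := by
    have h2 : (2 : ℝ≥0∞) ^ (1 / p) * ((2 : ℝ≥0∞) ^ τ)⁻¹ = ENNReal.ofReal d := by
      rw [← ENNReal.rpow_neg, ← ENNReal.rpow_add _ _ two_ne_zero ENNReal.ofNat_ne_top, hd,
        ← ENNReal.ofReal_rpow_of_pos two_pos, ← sub_eq_add_neg]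
      simp
    rw [hD, ENNReal.div_rpow_of_nonneg _ _ hτ0.le, ENNReal.ofReal_mul hK0.le, ← h2,
      div_eq_mul_inv (ν E ^ τ)]
    ring
  calc (∫⁻ y, (A.sup fun a => S (E ∩ {x | φ x < a}) y) ^ p ∂μ) ^ (1 / p)
      ≤ (∫⁻ y, (u + (l ⊔ r)) y ^ p ∂μ) ^ (1 / p) := by
        gcongr with y
        exact hpt y
    _ ≤ (∫⁻ y, u y ^ p ∂μ) ^ (1 / p) + (∫⁻ y, (l ⊔ r) y ^ p ∂μ) ^ (1 / p) :=
        ENNReal.lintegral_Lp_add_le hum.aemeasurable (hlm.sup hrm).aemeasurable hp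
    _ ≤ C * ν E ^ τ + ENNReal.ofReal (K * d) * C * ν E ^ τ := by
        gcongr
        · refine (hbd _ (hE.inter (hlt m))).trans ?_
          gcongr
          exact Set.inter_subset_left
        · exact hlr.trans_eq hD2
    _ = ENNReal.ofReal K * C * ν E ^ τ := by
        rw [mul_assoc, mul_assoc, ← one_add_mul, ← ENNReal.ofReal_one,
          ← ENNReal.ofReal_add zero_le_one (by positivity), hKd]

section Plancherel

open FourierTransform SchwartzMap

variable {V : Type*} [NormedAddCommGroup V] [InnerProductSpace ℝ V] [FiniteDimensional ℝ V]
  [MeasurableSpace V] [BorelSpace V]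

lemma continuous_fourier_of_integrable {h : V → ℂ} (h1 : Integrable h) : Continuous (𝓕 h) :=
  VectorFourier.fourierIntegral_continuous Real.continuous_fourierChar
    (L := innerₗ V) continuous_inner h1

/-- The Fourier integral of an `L¹ ∩ L²` function represents its `L²` Fourier transform. -/
lemma fourier_ae_eq_fourier_toLp {h : V → ℂ} (h1 : Integrable h) (h2 : MemLp h 2) :
    𝓕 h =ᵐ[volume] (𝓕 (h2.toLp h) : Lp (α := V) ℂ 2) := by
  refine ae_eq_of_integral_contDiff_smul_eq
    (continuous_fourier_of_integrable h1).locallyIntegrable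
    ((Lp.memLp _).locallyIntegrable one_le_two) fun g g_smooth g_cpt => ?_
  have hg₁ : HasCompactSupport (Complex.ofRealCLM ∘ g) := g_cpt.comp_left rfl
  have hg₂ : ContDiff ℝ (⊤ : ℕ∞) (Complex.ofRealCLM ∘ g) := by fun_prop
  set G : 𝓢(V, ℂ) := hg₁.toSchwartzMap hg₂ with hG
  have hGg (x : V) : G x = (g x : ℂ) := rfl
  have e1 := congrArg (fun T : 𝓢'(V, ℂ) => T G) (Lp.fourier_toTemperedDistribution_eq (h2.toLp h))
  simp only [TemperedDistribution.fourier_apply, Lp.toTemperedDistribution_apply] at e1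
  have e2 : ∫ x, (𝓕 G) x • (h2.toLp h) x = ∫ x, (𝓕 G) x • h x :=
    integral_congr_ae (h2.coeFn_toLp.mono fun x hx => by simp only [hx])
  have e3 : ∫ ξ, 𝓕 h ξ * G ξ = ∫ x, h x * 𝓕 (G : V → ℂ) x := by
    simpa using! VectorFourier.integral_bilin_fourierIntegral_eq_flip (.mul ℂ ℂ)
      (L := innerₗ V) Real.continuous_fourierChar continuous_inner h1 G.integrable
  simp only [← hGg, Complex.real_smul]
  rw [e2] at e1
  simp only [smul_eq_mul] at e1
  refine Eq.trans ?_ e1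
  calc ∫ x, G x * 𝓕 h x = ∫ x, 𝓕 h x * G x := by simp only [mul_comm (G _)]
    _ = ∫ x, h x * 𝓕 (G : V → ℂ) x := e3
    _ = ∫ x, (𝓕 G : 𝓢(V, ℂ)) x * h x := by simp only [SchwartzMap.fourier_coe, mul_comm (h _)]

lemma eLpNorm_fourier_eq {h : V → ℂ} (h1 : Integrable h) (h2 : MemLp h 2) :
    eLpNorm (𝓕 h) 2 volume = eLpNorm h 2 volume := by
  rw [eLpNorm_congr_ae (fourier_ae_eq_fourier_toLp h1 h2), ← Lp.enorm_def, ← ofReal_norm,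
    Lp.norm_fourier_eq, ofReal_norm, Lp.enorm_toLp]

lemma eLpNorm_fourierInv_eq {h : V → ℂ} (h1 : Integrable h) (h2 : MemLp h 2) :
    eLpNorm (𝓕⁻ h) 2 volume = eLpNorm h 2 volume := by
  rw [← eLpNorm_fourier_eq h1 h2, ← eLpNorm_comp_measurePreserving
    (continuous_fourier_of_integrable h1).aestronglyMeasurable
    (Measure.measurePreserving_neg (volume : Measure V))]
  congr 1
  ext x
  exact Real.fourierInv_eq_fourier_neg h x

end Plancherel

lemma lintegral_Ioc_rpow {a b : ℝ} (ha : -1 < a) (hb : 0 ≤ b) :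
    ∫⁻ t in Set.Ioc 0 b, ENNReal.ofReal (t ^ a) = ENNReal.ofReal (b ^ (a + 1) / (a + 1)) := by
  rw [← ofReal_integral_eq_lintegral_ofReal, ← intervalIntegral.integral_of_le hb,
    integral_rpow (Or.inl ha), Real.zero_rpow (by linarith), sub_zero]
  · exact (intervalIntegrable_iff_integrableOn_Ioc_of_le hb).1
      (intervalIntegral.intervalIntegrable_rpow' ha)
  · filter_upwards [ae_restrict_mem measurableSet_Ioc] with t ht
    exact Real.rpow_nonneg ht.1.le a

/-- The inner integral in the proof of the Hausdorff–Young inequality by real interpolation. -/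
lemma sq_mul_lintegral_rpow_le {p A x : ℝ} (hp : 2 < p) (hA : 0 ≤ A) (hx : 0 ≤ x) :
    ENNReal.ofReal (x ^ 2) *
        ∫⁻ t in Set.Ioi 0 ∩ {t : ℝ | t * x ^ (1 / (p - 1)) ≤ A}, ENNReal.ofReal (t ^ (p - 3)) ≤
      ENNReal.ofReal (A ^ (p - 2) / (p - 2) * x ^ (p / (p - 1))) := by
  rcases hx.eq_or_lt with rfl | hx
  · simp
  have hx' : 0 < x ^ (1 / (p - 1)) := by positivity
  have hset : Set.Ioi 0 ∩ {t : ℝ | t * x ^ (1 / (p - 1)) ≤ A} =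
      Set.Ioc 0 (A / x ^ (1 / (p - 1))) := by
    ext t
    simp only [Set.mem_inter_iff, Set.mem_Ioi, Set.mem_ofPred_eq, Set.mem_Ioc, le_div_iff₀ hx']
  rw [hset, lintegral_Ioc_rpow (by linarith) (by positivity), ← ENNReal.ofReal_mul (by positivity)]
  refine (congrArg ENNReal.ofReal ?_).le
  have h1 : p - 3 + 1 = p - 2 := by ring
  rw [h1, Real.div_rpow hA hx'.le, ← Real.rpow_mul hx.le]
  have h2 : x ^ (p / (p - 1)) * x ^ (1 / (p - 1) * (p - 2)) = x ^ 2 := by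
    rw [← Real.rpow_add hx, ← Real.rpow_natCast]
    congr 1
    have : p - 1 ≠ 0 := by linarith
    field_simp
    push_cast
    ring
  rw [← h2]
  have : x ^ (1 / (p - 1) * (p - 2)) ≠ 0 := by positivity
  field_simp

/-- Hausdorff–Young inequality for an additive operator bounded from `L¹` to `L^∞`
and on `L²`. -/
theorem hausdorffYoung {X Y : Type*} [MeasurableSpace X] [MeasurableSpace Y]
    (ν : Measure X) [SFinite ν] (μ : Measure Y) {p : ℝ} (hp : 2 < p)
    {T : (X → ℂ) → Y → ℂ}
    (hTm : ∀ h, Integrable h ν → Measurable (T h))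
    (hadd : ∀ h k, Integrable h ν → Integrable k ν → ∀ y, T (h + k) y = T h y + T k y)
    (h1 : ∀ h y, ‖T h y‖ₑ ≤ ∫⁻ x, ‖h x‖ₑ ∂ν)
    (h2 : ∀ h, Integrable h ν → MemLp h 2 ν →
      ∫⁻ y, ‖T h y‖ₑ ^ 2 ∂μ ≤ ∫⁻ x, ‖h x‖ₑ ^ 2 ∂ν)
    {h : X → ℂ} (hm : Measurable h) (hi : Integrable h ν) :
    ∫⁻ y, ‖T h y‖ₑ ^ p ∂μ ≤
      ENNReal.ofReal (2 ^ p * p / (p - 2)) * (∫⁻ x, ‖h x‖ₑ ^ (p / (p - 1)) ∂ν) ^ (p - 1) := by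
  have hp0 : 0 < p := by linarith
  have hp1 : 0 < p - 1 := by linarith
  have hp2 : 0 < p - 2 := by linarith
  set q := p / (p - 1) with hq
  have hq0 : 0 < q := by positivity
  have hq1 : 1 / (p - 1) + 1 = q := by rw [hq]; field_simp; ring
  set A' := ∫⁻ x, ‖h x‖ₑ ^ q ∂ν with hA'
  rcases eq_or_ne A' 0 with hA0 | hA0
  · have hz : ∫⁻ x, ‖h x‖ₑ ∂ν = 0 := by
      rw [hA', lintegral_eq_zero_iff (by fun_prop)] at hA0
      rw [lintegral_eq_zero_iff (by fun_prop)]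
      filter_upwards [hA0] with x hx
      simpa [hq0, hq0.le, hq0.not_gt] using hx
    have : ∀ y, ‖T h y‖ₑ = 0 := fun y => le_antisymm ((h1 h y).trans_eq hz) zero_le
    simp [this, ENNReal.zero_rpow_of_pos, hp0]
  rcases eq_or_ne A' ⊤ with hAt | hAt
  · rw [hAt, ENNReal.top_rpow_of_pos hp1, ENNReal.mul_top]
    · exact le_top
    · simp only [ne_eq, ENNReal.ofReal_eq_zero, not_le]; positivity
  obtain ⟨A, hAA⟩ : ∃ A : ℝ, A = A'.toReal := ⟨_, rfl⟩
  have hApos : 0 < A := hAA ▸ ENNReal.toReal_pos hA0 hAt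
  have hAof : A' = ENNReal.ofReal A := by rw [hAA, ENNReal.ofReal_toReal hAt]
  -- truncation at height `(A / t) ^ (p - 1)`
  have hlevel (t : ℝ) (ht : 0 < t) : μ {y | t < ‖T h y‖ / 2} * ENNReal.ofReal (t ^ (p - 1)) ≤
      ENNReal.ofReal (t ^ (p - 3)) *
        ∫⁻ x, {x | t * ‖h x‖ ^ (1 / (p - 1)) ≤ A}.indicator (fun x => ‖h x‖ₑ ^ 2) x ∂ν := by
    set s : Set X := {x | t * ‖h x‖ ^ (1 / (p - 1)) ≤ A} with hs
    have hsm : MeasurableSet s := measurableSet_le (by fun_prop) measurable_const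
    have hi1 : Integrable (s.indicator h) ν := hi.indicator hsm
    have hi2 : Integrable (sᶜ.indicator h) ν := hi.indicator hsm.compl
    have hsum : s.indicator h + sᶜ.indicator h = h := Set.indicator_self_add_compl s h
    have hbound : ∀ x ∈ s, ‖h x‖ ≤ (A / t) ^ (p - 1) := by
      intro x hx
      have hx' : ‖h x‖ ^ (1 / (p - 1)) ≤ A / t := by
        rw [le_div_iff₀ ht, mul_comm]; exact hx
      rw [one_div] at hx'
      exact (Real.rpow_inv_le_iff_of_pos (norm_nonneg _) (by positivity) hp1).1 hx'
    have hmem : MemLp (s.indicator h) 2 ν := by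
      refine (memLp_two_iff_integrable_sq_norm hi1.aestronglyMeasurable).2
        ((hi1.norm.const_mul ((A / t) ^ (p - 1))).mono' (hi1.aestronglyMeasurable.norm.pow 2)
          (Filter.Eventually.of_forall fun x => ?_))
      by_cases hx : x ∈ s
      · simp only [hx, Set.indicator_of_mem, norm_mul, norm_norm, sq]
        exact mul_le_mul_of_nonneg_right (hbound x hx) (norm_nonneg (h x))
      · simp [hx]
    have hlarge : ∫⁻ x, ‖sᶜ.indicator h x‖ₑ ∂ν ≤ ENNReal.ofReal t := by
      have hpt : ∀ x, ‖sᶜ.indicator h x‖ₑ ≤ ENNReal.ofReal (t / A) * ‖h x‖ₑ ^ q := by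
        intro x
        by_cases hx : x ∈ s
        · simp [hx]
        · have hx' : A ≤ t * ‖h x‖ ^ (1 / (p - 1)) := (not_le.1 hx).le
          rw [Set.indicator_of_mem (by exact hx), ← ofReal_norm,
            ENNReal.ofReal_rpow_of_nonneg (norm_nonneg _) hq0.le,
            ← ENNReal.ofReal_mul (by positivity)]
          refine ENNReal.ofReal_le_ofReal ?_
          rw [← hq1, Real.rpow_add_one' (norm_nonneg _) (by positivity), div_mul_eq_mul_div,
            le_div_iff₀ hApos]
          nlinarith [norm_nonneg (h x), mul_le_mul_of_nonneg_right hx' (norm_nonneg (h x))]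
      calc ∫⁻ x, ‖sᶜ.indicator h x‖ₑ ∂ν
          ≤ ∫⁻ x, ENNReal.ofReal (t / A) * ‖h x‖ₑ ^ q ∂ν := lintegral_mono hpt
        _ = ENNReal.ofReal (t / A) * ENNReal.ofReal A := by
          rw [lintegral_const_mul' _ _ ENNReal.ofReal_ne_top, ← hA', hAof]
        _ = ENNReal.ofReal t := by
          rw [← ENNReal.ofReal_mul (by positivity), div_mul_cancel₀ _ hApos.ne']
    have hsub : {y | t < ‖T h y‖ / 2} ⊆
        {y | ENNReal.ofReal (t ^ 2) ≤ ‖T (s.indicator h) y‖ₑ ^ 2} := by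
      intro y hy
      simp only [Set.mem_ofPred_eq] at hy ⊢
      have e1 : ‖T (sᶜ.indicator h) y‖ ≤ t := by
        have := (h1 (sᶜ.indicator h) y).trans hlarge
        rwa [← ofReal_norm, ENNReal.ofReal_le_ofReal_iff ht.le] at this
      have e2 : ‖T h y‖ ≤ ‖T (s.indicator h) y‖ + ‖T (sᶜ.indicator h) y‖ := by
        conv_lhs => rw [← hsum, hadd _ _ hi1 hi2]
        exact norm_add_le _ _
      rw [← ofReal_norm, ← ENNReal.ofReal_pow (norm_nonneg _)]
      exact ENNReal.ofReal_le_ofReal (pow_le_pow_left₀ ht.le (by linarith) 2)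
    have hcheb : ENNReal.ofReal (t ^ 2) * μ {y | t < ‖T h y‖ / 2} ≤
        ∫⁻ x, s.indicator (fun x => ‖h x‖ₑ ^ 2) x ∂ν := by
      calc ENNReal.ofReal (t ^ 2) * μ {y | t < ‖T h y‖ / 2}
          ≤ ENNReal.ofReal (t ^ 2) *
              μ {y | ENNReal.ofReal (t ^ 2) ≤ ‖T (s.indicator h) y‖ₑ ^ 2} := by gcongr
        _ ≤ ∫⁻ y, ‖T (s.indicator h) y‖ₑ ^ 2 ∂μ :=
            mul_meas_ge_le_lintegral (((hTm _ hi1).enorm).pow_const 2) _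
        _ ≤ ∫⁻ x, ‖s.indicator h x‖ₑ ^ 2 ∂ν := h2 _ hi1 hmem
        _ = _ := by
          refine lintegral_congr fun x => ?_
          by_cases hx : x ∈ s <;> simp [hx]
    have hpow : t ^ (p - 1) = t ^ (p - 3) * t ^ 2 := by
      rw [← Real.rpow_natCast, ← Real.rpow_add ht]
      congr 1; push_cast; ring
    calc μ {y | t < ‖T h y‖ / 2} * ENNReal.ofReal (t ^ (p - 1))
        = ENNReal.ofReal (t ^ (p - 3)) *
            (ENNReal.ofReal (t ^ 2) * μ {y | t < ‖T h y‖ / 2}) := by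
          rw [hpow, ENNReal.ofReal_mul (by positivity)]; ring
      _ ≤ _ := by gcongr
  have hlayer : ∫⁻ y, ENNReal.ofReal ((‖T h y‖ / 2) ^ p) ∂μ =
      ENNReal.ofReal p * ∫⁻ t in Set.Ioi 0, μ {y | t < ‖T h y‖ / 2} *
        ENNReal.ofReal (t ^ (p - 1)) :=
    lintegral_rpow_eq_lintegral_meas_lt_mul μ
      (Filter.Eventually.of_forall fun y => by simp only [Pi.zero_apply]; positivity)
      ((hTm h hi).norm.div_const 2).aemeasurable hp0
  have hmeas2 : MeasurableSet {z : ℝ × X | z.1 * ‖h z.2‖ ^ (1 / (p - 1)) ≤ A} :=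
    measurableSet_le (by fun_prop) measurable_const
  have hdouble : ∫⁻ t in Set.Ioi 0, μ {y | t < ‖T h y‖ / 2} * ENNReal.ofReal (t ^ (p - 1)) ≤
      ENNReal.ofReal (A ^ (p - 2) / (p - 2)) * ENNReal.ofReal A := by
    calc ∫⁻ t in Set.Ioi 0, μ {y | t < ‖T h y‖ / 2} * ENNReal.ofReal (t ^ (p - 1))
        ≤ ∫⁻ t in Set.Ioi 0, ENNReal.ofReal (t ^ (p - 3)) *
            ∫⁻ x, {x | t * ‖h x‖ ^ (1 / (p - 1)) ≤ A}.indicator (fun x => ‖h x‖ₑ ^ 2) x ∂ν := by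
          refine lintegral_mono_ae ?_
          filter_upwards [ae_restrict_mem measurableSet_Ioi] with t ht
          exact hlevel t ht
      _ = ∫⁻ t in Set.Ioi 0, ∫⁻ x,
            {z : ℝ × X | z.1 * ‖h z.2‖ ^ (1 / (p - 1)) ≤ A}.indicator
              (fun z => ENNReal.ofReal (z.1 ^ (p - 3)) * ‖h z.2‖ₑ ^ 2) (t, x) ∂ν := by
          refine lintegral_congr fun t => ?_
          rw [← lintegral_const_mul' _ _ ENNReal.ofReal_ne_top]
          refine lintegral_congr fun x => ?_
          simp only [Set.indicator_apply, Set.mem_ofPred_eq]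
          split_ifs <;> simp
      _ = ∫⁻ x, (∫⁻ t in Set.Ioi 0,
            {z : ℝ × X | z.1 * ‖h z.2‖ ^ (1 / (p - 1)) ≤ A}.indicator
              (fun z => ENNReal.ofReal (z.1 ^ (p - 3)) * ‖h z.2‖ₑ ^ 2) (t, x)) ∂ν := by
          refine lintegral_lintegral_swap (Measurable.aemeasurable ?_)
          exact Measurable.indicator (by fun_prop) hmeas2
      _ ≤ ∫⁻ x, ENNReal.ofReal (A ^ (p - 2) / (p - 2)) * ‖h x‖ₑ ^ q ∂ν := by
          refine lintegral_mono fun x => ?_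
          have hsm : MeasurableSet {t : ℝ | t * ‖h x‖ ^ (1 / (p - 1)) ≤ A} :=
            measurableSet_le (by fun_prop) measurable_const
          have hkey := sq_mul_lintegral_rpow_le hp hApos.le (norm_nonneg (h x))
          rw [ENNReal.ofReal_mul (by positivity), ← ENNReal.ofReal_rpow_of_nonneg (norm_nonneg _)
            hq0.le, ENNReal.ofReal_pow (norm_nonneg _), ofReal_norm, Set.inter_comm,
            ← Measure.restrict_restrict hsm, ← lintegral_indicator hsm,
            ← lintegral_const_mul' _ _ (by simp)] at hkey
          refine le_trans (le_of_eq (lintegral_congr fun t => ?_)) hkey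
          simp only [Set.indicator_apply, Set.mem_ofPred_eq]
          split_ifs <;> simp [mul_comm]
      _ = _ := by rw [lintegral_const_mul' _ _ ENNReal.ofReal_ne_top, ← hA', hAof]
  have hscale : ∫⁻ y, ‖T h y‖ₑ ^ p ∂μ =
      ENNReal.ofReal (2 ^ p) * ∫⁻ y, ENNReal.ofReal ((‖T h y‖ / 2) ^ p) ∂μ := by
    rw [← lintegral_const_mul' _ _ ENNReal.ofReal_ne_top]
    refine lintegral_congr fun y => ?_
    rw [← ofReal_norm, ENNReal.ofReal_rpow_of_nonneg (norm_nonneg _) hp0.le,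
      ← ENNReal.ofReal_mul (by positivity), ← Real.mul_rpow (by norm_num) (by positivity)]
    congr 2; ring
  rw [hscale, hlayer, hAof, ENNReal.ofReal_rpow_of_pos hApos, ← ENNReal.ofReal_mul (by positivity)]
  calc ENNReal.ofReal (2 ^ p) * (ENNReal.ofReal p * _)
      ≤ ENNReal.ofReal (2 ^ p) * (ENNReal.ofReal p *
          (ENNReal.ofReal (A ^ (p - 2) / (p - 2)) * ENNReal.ofReal A)) := by gcongr
    _ = _ := by
      rw [← ENNReal.ofReal_mul (by positivity), ← ENNReal.ofReal_mul (by positivity),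
        ← ENNReal.ofReal_mul (by positivity)]
      congr 1
      have : A ^ (p - 1) = A ^ (p - 2) * A := by
        rw [← Real.rpow_add_one hApos.ne']; congr 1; ring
      rw [this]
      ring

/-- The inverse Fourier integral on `ℝ²`. -/
noncomputable def invFT2 (h : ℝ × ℝ → ℂ) (ξ : ℝ × ℝ) : ℂ :=
  ∫ w : ℝ × ℝ, h w * Complex.exp (2 * π * Complex.I * (ξ.1 * w.1 + ξ.2 * w.2))

section Transfer

open FourierTransform SchwartzMap

lemma integral_comp_toLp {G : Type*} [NormedAddCommGroup G] [NormedSpace ℝ G]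
    (F : WithLp 2 (ℝ × ℝ) → G) : ∫ w : ℝ × ℝ, F (WithLp.toLp 2 w) = ∫ v, F v :=
  (WithLp.volume_preserving_symm_measurableEquiv_toLp_prod ℝ ℝ).symm.integral_comp' F

lemma invFT2_eq_fourierInv (h : ℝ × ℝ → ℂ) (ξ : ℝ × ℝ) :
    invFT2 h ξ = 𝓕⁻ (fun v : WithLp 2 (ℝ × ℝ) => h v.ofLp) (WithLp.toLp 2 ξ) := by
  rw [Real.fourierInv_eq', ← integral_comp_toLp, invFT2]
  refine integral_congr_ae (Filter.Eventually.of_forall fun w => ?_)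
  simp only [WithLp.prod_inner_apply, smul_eq_mul, mul_comm (h w)]
  congr 2
  simp
  ring

lemma FT2_eq_fourier (h : ℝ × ℝ → ℂ) (ξ : ℝ × ℝ) :
    FT2 h ξ = 𝓕 (fun v : WithLp 2 (ℝ × ℝ) => h v.ofLp) (WithLp.toLp 2 ξ) := by
  rw [Real.fourier_eq', ← integral_comp_toLp, FT2]
  refine integral_congr_ae (Filter.Eventually.of_forall fun w => ?_)
  simp only [WithLp.prod_inner_apply, smul_eq_mul, mul_comm (h w)]
  congr 2
  simp
  ring

lemma FT2_schwartz (f : 𝓢(ℝ × ℝ, ℂ)) : Continuous (FT2 f) ∧ Integrable (FT2 f) := by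
  set F : 𝓢(WithLp 2 (ℝ × ℝ), ℂ) :=
    𝓕 (SchwartzMap.compCLMOfContinuousLinearEquiv ℂ
      (WithLp.prodContinuousLinearEquiv 2 ℝ ℝ ℝ) f) with hF
  have heq : FT2 f = fun ξ => F (WithLp.toLp 2 ξ) := by
    ext ξ
    rw [FT2_eq_fourier, hF, SchwartzMap.fourier_coe]
    rfl
  rw [heq]
  exact ⟨F.continuous.comp (WithLp.prod_continuous_toLp 2 ℝ ℝ),
    (WithLp.volume_preserving_toLp ℝ ℝ).integrable_comp_of_integrable F.integrable⟩

lemma integrable_comp_ofLp {h : ℝ × ℝ → ℂ} (h1 : Integrable h) :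
    Integrable fun v : WithLp 2 (ℝ × ℝ) => h v.ofLp :=
  (WithLp.volume_preserving_ofLp ℝ ℝ).integrable_comp_of_integrable h1

lemma continuous_invFT2 {h : ℝ × ℝ → ℂ} (h1 : Integrable h) : Continuous (invFT2 h) := by
  have heq : invFT2 h = fun ξ : ℝ × ℝ =>
      𝓕 (fun v : WithLp 2 (ℝ × ℝ) => h v.ofLp) (-WithLp.toLp 2 ξ) := by
    ext ξ
    rw [invFT2_eq_fourierInv, Real.fourierInv_eq_fourier_neg]
  rw [heq]
  exact (continuous_fourier_of_integrable (integrable_comp_ofLp h1)).comp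
    (WithLp.prod_continuous_toLp 2 ℝ ℝ).neg

lemma lintegral_enorm_sq_invFT2_le {h : ℝ × ℝ → ℂ} (h1 : Integrable h) (h2 : MemLp h 2) :
    ∫⁻ ξ, ‖invFT2 h ξ‖ₑ ^ 2 ≤ ∫⁻ w, ‖h w‖ₑ ^ 2 := by
  have key := eLpNorm_fourierInv_eq (integrable_comp_ofLp h1)
    (h2.comp_measurePreserving (WithLp.volume_preserving_ofLp ℝ ℝ))
  have e1 : eLpNorm (invFT2 h) 2 volume =
      eLpNorm (𝓕⁻ (fun v : WithLp 2 (ℝ × ℝ) => h v.ofLp)) 2 volume := by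
    have hc : 𝓕⁻ (fun v : WithLp 2 (ℝ × ℝ) => h v.ofLp) = invFT2 h ∘ WithLp.ofLp := by
      ext v; rw [Function.comp_apply, invFT2_eq_fourierInv]
    rw [hc]
    exact (eLpNorm_comp_measurePreserving (continuous_invFT2 h1).aestronglyMeasurable
      (WithLp.volume_preserving_ofLp ℝ ℝ)).symm
  have e2 : eLpNorm (fun v : WithLp 2 (ℝ × ℝ) => h v.ofLp) 2 volume = eLpNorm h 2 volume :=
    eLpNorm_comp_measurePreserving h1.aestronglyMeasurable (WithLp.volume_preserving_ofLp ℝ ℝ)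
  rw [← e1] at key
  have key' := (key.trans e2).le
  rw [eLpNorm_eq_lintegral_rpow_enorm_toReal two_ne_zero ENNReal.ofNat_ne_top,
    eLpNorm_eq_lintegral_rpow_enorm_toReal two_ne_zero ENNReal.ofNat_ne_top,
    ENNReal.rpow_le_rpow_iff (by norm_num)] at key'
  simpa using key'

end Transfer

lemma enorm_exp_phase (ξ w : ℝ × ℝ) :
    ‖Complex.exp (2 * π * Complex.I * (ξ.1 * w.1 + ξ.2 * w.2))‖ₑ = 1 := by
  rw [← ofReal_norm]
  have : (2 * π * Complex.I * (ξ.1 * w.1 + ξ.2 * w.2) : ℂ) =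
      ((2 * π * (ξ.1 * w.1 + ξ.2 * w.2) : ℝ) : ℂ) * Complex.I := by push_cast; ring
  rw [this, Complex.norm_exp_ofReal_mul_I, ENNReal.ofReal_one]

lemma enorm_invFT2_le (h : ℝ × ℝ → ℂ) (ξ : ℝ × ℝ) : ‖invFT2 h ξ‖ₑ ≤ ∫⁻ w, ‖h w‖ₑ := by
  refine (enorm_integral_le_lintegral_enorm _).trans_eq (lintegral_congr fun w => ?_)
  rw [enorm_mul, enorm_exp_phase, mul_one]

lemma integrable_mul_phase {h : ℝ × ℝ → ℂ} (h1 : Integrable h) (ξ : ℝ × ℝ) :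
    Integrable fun w : ℝ × ℝ =>
      h w * Complex.exp (2 * π * Complex.I * (ξ.1 * w.1 + ξ.2 * w.2)) := by
  refine h1.mono (h1.aestronglyMeasurable.mul (by fun_prop))
    (Filter.Eventually.of_forall fun w => ?_)
  rw [← enorm_le_iff_norm_le, enorm_mul, enorm_exp_phase, mul_one]

lemma invFT2_add {h k : ℝ × ℝ → ℂ} (hh : Integrable h) (hk : Integrable k) (ξ : ℝ × ℝ) :
    invFT2 (h + k) ξ = invFT2 h ξ + invFT2 k ξ := by
  simp only [invFT2, Pi.add_apply, add_mul]
  exact integral_add (integrable_mul_phase hh ξ) (integrable_mul_phase hk ξ)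

/-- Quadrant truncations depend left-continuously on the corner, so rational corners suffice. -/
lemma enorm_invFT2_quadrant_le_iSup {g : ℝ × ℝ → ℂ} (hg : Integrable g) (ξ : ℝ × ℝ) (a b : ℝ) :
    ‖invFT2 ({w : ℝ × ℝ | w.1 < a ∧ w.2 < b}.indicator g) ξ‖ₑ ≤
      ⨆ (r : ℚ) (s : ℚ), ‖invFT2 ({w : ℝ × ℝ | w.1 < r ∧ w.2 < s}.indicator g) ξ‖ₑ := by
  obtain ⟨u, -, hua, hu⟩ := Real.exists_seq_rat_strictMono_tendsto a
  obtain ⟨v, -, hvb, hv⟩ := Real.exists_seq_rat_strictMono_tendsto b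
  have hmeas (a b : ℝ) : MeasurableSet {w : ℝ × ℝ | w.1 < a ∧ w.2 < b} :=
    (measurableSet_lt measurable_fst measurable_const).inter
      (measurableSet_lt measurable_snd measurable_const)
  have hlim : Filter.Tendsto
      (fun n => invFT2 ({w : ℝ × ℝ | w.1 < u n ∧ w.2 < v n}.indicator g) ξ) Filter.atTop
      (nhds (invFT2 ({w : ℝ × ℝ | w.1 < a ∧ w.2 < b}.indicator g) ξ)) := by
    refine tendsto_integral_of_dominated_convergence (fun w => ‖g w‖)
      (fun n => (integrable_mul_phase (hg.indicator (hmeas _ _)) ξ).aestronglyMeasurable)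
      hg.norm (fun n => Filter.Eventually.of_forall fun w => ?_)
      (Filter.Eventually.of_forall fun w => ?_)
    · rw [← enorm_le_iff_norm_le, enorm_mul, enorm_exp_phase, mul_one]
      exact enorm_indicator_le_enorm_self _ _
    · refine Filter.Tendsto.mul_const _ (tendsto_nhds_of_eventually_eq ?_)
      by_cases hw : w.1 < a ∧ w.2 < b
      · filter_upwards [hu.eventually (lt_mem_nhds hw.1), hv.eventually (lt_mem_nhds hw.2)] with n h1 h2
        rw [Set.indicator_of_mem (show w ∈ {w : ℝ × ℝ | w.1 < u n ∧ w.2 < v n} from ⟨h1, h2⟩),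
          Set.indicator_of_mem (show w ∈ {w : ℝ × ℝ | w.1 < a ∧ w.2 < b} from hw)]
      · refine Filter.Eventually.of_forall fun n => ?_
        rw [Set.indicator_of_notMem (show w ∉ {w : ℝ × ℝ | w.1 < a ∧ w.2 < b} from hw),
          Set.indicator_of_notMem]
        exact fun h => hw ⟨h.1.trans (hua n), h.2.trans (hvb n)⟩
  exact le_of_tendsto' hlim.enorm fun n =>
    le_iSup₂ (f := fun r s : ℚ =>
      ‖invFT2 ({w : ℝ × ℝ | w.1 < r ∧ w.2 < s}.indicator g) ξ‖ₑ) (u n) (v n)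

/-- Maximal Hausdorff–Young inequality over finitely many quadrants. -/
lemma lintegral_finset_sup_quadrant_le {p : ℝ} (hp : 2 < p) {g : ℝ × ℝ → ℂ} (hgm : Measurable g)
    (hg : Integrable g) (hfin : ∫⁻ w, ‖g w‖ₑ ^ (p / (p - 1)) ≠ ⊤) (A B : Finset ℝ) :
    (∫⁻ ξ, (A.sup fun a => B.sup fun b =>
        ‖invFT2 ({w : ℝ × ℝ | w.1 < a ∧ w.2 < b}.indicator g) ξ‖ₑ) ^ p) ^ (1 / p) ≤
      ENNReal.ofReal (1 - 2 ^ (1 / p - (p - 1) / p))⁻¹ *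
        (ENNReal.ofReal (1 - 2 ^ (1 / p - (p - 1) / p))⁻¹ *
          ENNReal.ofReal (2 ^ p * p / (p - 2)) ^ (1 / p)) *
        (∫⁻ w, ‖g w‖ₑ ^ (p / (p - 1))) ^ ((p - 1) / p) := by
  have hp0 : 0 < p := by linarith
  have hp1 : 0 < p - 1 := by linarith
  have hp' : 0 < 1 / p := by positivity
  have hτ : 1 / p < (p - 1) / p := by gcongr; linarith
  set q := p / (p - 1) with hq
  have hq0 : 0 < q := by positivity
  set ν : Measure (ℝ × ℝ) := volume.withDensity fun w => ‖g w‖ₑ ^ q with hν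
  have : IsFiniteMeasure ν := isFiniteMeasure_withDensity hfin
  set S : Set (ℝ × ℝ) → ℝ × ℝ → ℝ≥0∞ := fun E ξ => ‖invFT2 (E.indicator g) ξ‖ₑ with hS
  have hSm (E) (hE : MeasurableSet E) : Measurable (S E) :=
    (continuous_invFT2 (hg.indicator hE)).measurable.enorm
  have hSsub (E F) (hE : MeasurableSet E) (hF : MeasurableSet F) (hd : Disjoint E F) (ξ) :
      S (E ∪ F) ξ ≤ S E ξ + S F ξ := by
    simp only [hS]
    rw [Set.indicator_union_of_disjoint hd]
    refine (congrArg _ (invFT2_add (hg.indicator hE) (hg.indicator hF) ξ)).trans_le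
      (enorm_add_le _ _)
  have hSbd (E) (hE : MeasurableSet E) : (∫⁻ ξ, S E ξ ^ p) ^ (1 / p) ≤
      ENNReal.ofReal (2 ^ p * p / (p - 2)) ^ (1 / p) * ν E ^ ((p - 1) / p) := by
    have h1 := hausdorffYoung volume volume hp (T := invFT2)
      (fun h hh => (continuous_invFT2 hh).measurable) (fun h k hh hk => invFT2_add hh hk)
      enorm_invFT2_le (fun h => lintegral_enorm_sq_invFT2_le) (hgm.indicator hE)
      (hg.indicator hE)
    have h2 : ∫⁻ w, ‖E.indicator g w‖ₑ ^ q = ν E := by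
      rw [hν, withDensity_apply _ hE, ← lintegral_indicator hE]
      refine lintegral_congr fun w => ?_
      by_cases hw : w ∈ E <;> simp [hw, hq0]
    rw [← hq, h2] at h1
    refine (ENNReal.rpow_le_rpow h1 hp'.le).trans_eq ?_
    rw [ENNReal.mul_rpow_of_nonneg _ _ hp'.le, ← ENNReal.rpow_mul, mul_one_div]
  have h1 := christKiselev_finset ν volume (by linarith) hτ hSm hSsub hSbd measurable_snd B
  have hmeas (b : ℝ) : MeasurableSet {w : ℝ × ℝ | w.2 < b} :=
    measurableSet_lt measurable_snd measurable_const
  have h2 := christKiselev_finset ν volume (by linarith) hτ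
    (S := fun E ξ => B.sup fun b => S (E ∩ {w | w.2 < b}) ξ)
    (fun E hE => by
      simp only [Finset.sup_eq_iSup]
      exact .biSup _ B.countable_toSet fun b _ => hSm _ (hE.inter (hmeas b)))
    (fun E F hE hF hd ξ => by
      refine Finset.sup_le fun b hb => ?_
      rw [Set.union_inter_distrib_right]
      refine (hSsub _ _ (hE.inter (hmeas b)) (hF.inter (hmeas b))
        (hd.mono Set.inter_subset_left Set.inter_subset_left) ξ).trans ?_
      exact add_le_add (Finset.le_sup (f := fun b => S (E ∩ {w | w.2 < b}) ξ) hb)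
        (Finset.le_sup (f := fun b => S (F ∩ {w | w.2 < b}) ξ) hb))
    h1 measurable_fst A Set.univ MeasurableSet.univ
  have h3 : ν Set.univ = ∫⁻ w, ‖g w‖ₑ ^ q := by
    rw [hν, withDensity_apply _ MeasurableSet.univ, Measure.restrict_univ]
  rw [h3] at h2
  refine le_trans (le_of_eq ?_) h2
  congr 2
  ext ξ
  simp only [Set.univ_inter]
  rfl

/-- biparameter Menshov–Zygmund–Carleson estimate: for `p > 2`,
the maximal partial Fourier inversion operator over half-infinite rectangles is
bounded from `W_p[W_p](ℝ²)` to `L^p(ℝ²)`. -/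
theorem stmt18 (p : ℝ) (hp : 2 < p) :
    ∃ C : ℝ, 0 < C ∧ ∀ f : SchwartzMap (ℝ × ℝ) ℂ,
      eLpNorm (fun ξ : ℝ × ℝ => ⨆ a : ℝ, ⨆ b : ℝ,
          ‖∫ w in {w : ℝ × ℝ | w.1 < a ∧ w.2 < b},
              FT2 ⇑f w * Complex.exp (2 * π * Complex.I * (ξ.1 * w.1 + ξ.2 * w.2))‖)
        (ENNReal.ofReal p) volume ≤
        ENNReal.ofReal C * eLpNorm (FT2 ⇑f) (ENNReal.ofReal (p / (p - 1))) volume := by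
  have hp0 : 0 < p := by linarith
  have hp1 : 0 < p - 1 := by linarith
  have hp2 : 0 < p - 2 := by linarith
  have hp' : 0 < 1 / p := by positivity
  have hq0 : 0 < p / (p - 1) := by positivity
  have hτ : 1 / p < (p - 1) / p := by gcongr; linarith
  set K : ℝ := (1 - 2 ^ (1 / p - (p - 1) / p))⁻¹ with hK
  have hK0 : 0 < K := inv_pos.2 (sub_pos.2
    (Real.rpow_lt_one_of_one_lt_of_neg (by norm_num) (by linarith)))
  have hD : 0 < 2 ^ p * p / (p - 2) := by positivity
  refine ⟨K * (K * (2 ^ p * p / (p - 2)) ^ (1 / p)), by positivity, fun f => ?_⟩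
  obtain ⟨hgc, hg⟩ := FT2_schwartz f
  set g := FT2 f
  have hC : ENNReal.ofReal (K * (K * (2 ^ p * p / (p - 2)) ^ (1 / p))) =
      ENNReal.ofReal K * (ENNReal.ofReal K *
        ENNReal.ofReal (2 ^ p * p / (p - 2)) ^ (1 / p)) := by
    rw [ENNReal.ofReal_mul hK0.le, ENNReal.ofReal_mul hK0.le,
      ENNReal.ofReal_rpow_of_pos hD]
  have hrhs : eLpNorm g (ENNReal.ofReal (p / (p - 1))) volume =
      (∫⁻ w, ‖g w‖ₑ ^ (p / (p - 1))) ^ ((p - 1) / p) := by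
    rw [eLpNorm_eq_lintegral_rpow_enorm_toReal (by simpa using hq0) ENNReal.ofReal_ne_top,
      ENNReal.toReal_ofReal hq0.le, one_div_div]
  rw [eLpNorm_eq_lintegral_rpow_enorm_toReal (by simpa using hp0) ENNReal.ofReal_ne_top,
    ENNReal.toReal_ofReal hp0.le, hrhs, hC]
  by_cases hfin : ∫⁻ w, ‖g w‖ₑ ^ (p / (p - 1)) = ⊤
  · rw [hfin, ENNReal.top_rpow_of_pos (by positivity), ENNReal.mul_top]
    · exact le_top
    · rw [← hC]
      simp only [ne_eq, ENNReal.ofReal_eq_zero, not_le]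
      positivity
  have hmeas (a b : ℝ) : MeasurableSet {w : ℝ × ℝ | w.1 < a ∧ w.2 < b} :=
    (measurableSet_lt measurable_fst measurable_const).inter
      (measurableSet_lt measurable_snd measurable_const)
  set Φ : ℝ → ℝ → ℝ × ℝ → ℝ≥0∞ := fun a b ξ =>
    ‖invFT2 ({w : ℝ × ℝ | w.1 < a ∧ w.2 < b}.indicator g) ξ‖ₑ with hΦ
  have hΦm (a b : ℝ) : Measurable (Φ a b) :=
    (continuous_invFT2 (hg.indicator (hmeas a b))).measurable.enorm
  set Q : Finset ℚ → ℝ × ℝ → ℝ≥0∞ := fun A ξ =>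
    (A.image ((↑) : ℚ → ℝ)).sup fun a => (A.image ((↑) : ℚ → ℝ)).sup fun b => Φ a b ξ with hQ
  have hQm (A : Finset ℚ) : Measurable (Q A) := by
    simp only [hQ, Finset.sup_eq_iSup]
    exact .biSup _ (Finset.countable_toSet _) fun a _ =>
      .biSup _ (Finset.countable_toSet _) fun b _ => hΦm a b
  have hQmono : Monotone Q := fun A B hAB ξ =>
    (Finset.sup_mono (Finset.image_subset_image hAB)).trans
      (Finset.sup_mono_fun fun a _ => Finset.sup_mono (Finset.image_subset_image hAB))
  have hpt (ξ : ℝ × ℝ) : ‖⨆ a : ℝ, ⨆ b : ℝ, ‖∫ w in {w : ℝ × ℝ | w.1 < a ∧ w.2 < b},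
      g w * Complex.exp (2 * π * Complex.I * (ξ.1 * w.1 + ξ.2 * w.2))‖‖ₑ ≤ ⨆ A, Q A ξ := by
    have hint (a b : ℝ) : ∫ w in {w : ℝ × ℝ | w.1 < a ∧ w.2 < b},
        g w * Complex.exp (2 * π * Complex.I * (ξ.1 * w.1 + ξ.2 * w.2)) =
        invFT2 ({w : ℝ × ℝ | w.1 < a ∧ w.2 < b}.indicator g) ξ := by
      rw [← integral_indicator (hmeas a b), invFT2]
      refine integral_congr_ae (Filter.Eventually.of_forall fun w => ?_)
      simp only [Set.indicator_apply]
      split_ifs <;> simp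
    simp only [hint]
    set M := ⨆ (r : ℚ) (s : ℚ), Φ r s ξ with hM
    have hMt : M ≠ ⊤ := by
      refine ne_top_of_le_ne_top (hasFiniteIntegral_iff_enorm.1 hg.2).ne (iSup₂_le fun r s => ?_)
      refine (enorm_invFT2_le _ ξ).trans (lintegral_mono fun w => ?_)
      exact enorm_indicator_le_enorm_self _ _
    have hMQ : M ≤ ⨆ A, Q A ξ := by
      refine iSup₂_le fun r s => le_iSup_of_le {r, s} ?_
      have hr : (r : ℝ) ∈ ({r, s} : Finset ℚ).image ((↑) : ℚ → ℝ) :=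
        Finset.mem_image_of_mem _ (by simp)
      have hs : (s : ℝ) ∈ ({r, s} : Finset ℚ).image ((↑) : ℚ → ℝ) :=
        Finset.mem_image_of_mem _ (by simp)
      exact (Finset.le_sup (f := fun b => Φ r b ξ) hs).trans
        (Finset.le_sup (f := fun a => (Finset.image ((↑) : ℚ → ℝ) {r, s}).sup
          fun b => Φ a b ξ) hr)
    refine le_trans ?_ hMQ
    have hle : (⨆ a : ℝ, ⨆ b : ℝ,
        ‖invFT2 ({w : ℝ × ℝ | w.1 < a ∧ w.2 < b}.indicator g) ξ‖) ≤ M.toReal :=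
      Real.iSup_le (fun a => Real.iSup_le (fun b => by
        rw [← toReal_enorm]
        exact ENNReal.toReal_mono hMt (enorm_invFT2_quadrant_le_iSup hg ξ a b))
        ENNReal.toReal_nonneg) ENNReal.toReal_nonneg
    have hnn : 0 ≤ ⨆ a : ℝ, ⨆ b : ℝ,
        ‖invFT2 ({w : ℝ × ℝ | w.1 < a ∧ w.2 < b}.indicator g) ξ‖ :=
      Real.iSup_nonneg fun a => Real.iSup_nonneg fun b => norm_nonneg _
    rw [Real.enorm_of_nonneg hnn]
    exact ENNReal.ofReal_le_of_le_toReal hle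
  have hsup : ∫⁻ ξ, (⨆ A, Q A ξ) ^ p = ⨆ A, ∫⁻ ξ, Q A ξ ^ p := by
    rw [← lintegral_iSup_directed (fun A => ((hQm A).pow_const p).aemeasurable)]
    · refine lintegral_congr fun ξ => ?_
      exact (ENNReal.orderIsoRpow p hp0).map_iSup fun A => Q A ξ
    · exact Monotone.directed_le fun A B hAB ξ => by
        dsimp only
        gcongr
        exact hQmono hAB ξ
  refine le_trans (ENNReal.rpow_le_rpow (lintegral_mono fun ξ =>
    ENNReal.rpow_le_rpow (hpt ξ) hp0.le) hp'.le) ?_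
  rw [hsup, one_div, ENNReal.rpow_inv_le_iff hp0]
  refine iSup_le fun A => ?_
  rw [← ENNReal.rpow_inv_le_iff hp0, ← one_div]
  exact lintegral_finset_sup_quadrant_le hp hgc.measurable hg hfin _ _
end
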